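/- arXiv:2012.12929 — 2 statements merged into one kernel-verified Lean document; each statement's English description precedes it below -/
import Mathlib

section
/- Let L ⊂ ℝ^n be a bimodular lattice of rank n and let ξ be a characteristic covector of L. Then ξ·ξ is an integer, and ξ·ξ ≡ n+1 (mod 8) or ξ·ξ ≡ n−1 (mod 8). -/
open scoped RealInnerProductSpace

noncomputable section

/-- The dual of a subset of Euclidean space: vectors pairing integrally with everything. -/
def dualSet {n : ℕ} (Λ : Set (EuclideanSpace ℝ (Fin n))) : Set (EuclideanSpace ℝ (Fin n)) :=
  {x | ∀ v ∈ Λ, ∃ k : ℤ, ⟪x, v⟫ = (k : ℝ)}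

/-- A (positive definite integral) lattice of full rank `n` in `ℝ^n`: an additive subgroup,
free abelian of rank `n` (it has a `ℤ`-basis indexed by `Fin n`), spanning `ℝ^n` over `ℝ`,
with all pairwise inner products integral. -/
def IsLattice {n : ℕ} (Λ : Set (EuclideanSpace ℝ (Fin n))) : Prop :=
  (0 ∈ Λ ∧ (∀ x ∈ Λ, ∀ y ∈ Λ, x + y ∈ Λ) ∧ (∀ x ∈ Λ, -x ∈ Λ)) ∧
  (∃ b : Fin n → EuclideanSpace ℝ (Fin n),
      (∀ i, b i ∈ Λ) ∧ LinearIndependent ℤ b ∧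
      ∀ x ∈ Λ, ∃ c : Fin n → ℤ, x = ∑ i, (c i : ℝ) • b i) ∧
  Submodule.span ℝ Λ = ⊤ ∧
  ∀ v ∈ Λ, ∀ w ∈ Λ, ∃ k : ℤ, ⟪v, w⟫ = (k : ℝ)

/-- A unimodular lattice: a lattice equal to its own dual. -/
def IsUnimodular {n : ℕ} (Λ : Set (EuclideanSpace ℝ (Fin n))) : Prop :=
  IsLattice Λ ∧ dualSet Λ = Λ

/-- A bimodular lattice: a lattice of index 2 in its dual. -/
def IsBimodular {n : ℕ} (Λ : Set (EuclideanSpace ℝ (Fin n))) : Prop :=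
  IsLattice Λ ∧
  ∃ w ∈ dualSet Λ \ Λ, ∀ x ∈ dualSet Λ, x ∈ Λ ∨ x - w ∈ Λ

/-- Characteristic covectors: elements `ξ` of the dual with `ξ·v ≡ v·v (mod 2)` for all `v ∈ Λ`. -/
def CharSet {n : ℕ} (Λ : Set (EuclideanSpace ℝ (Fin n))) : Set (EuclideanSpace ℝ (Fin n)) :=
  {ξ | ξ ∈ dualSet Λ ∧ ∀ v ∈ Λ, ∃ k : ℤ, ⟪ξ, v⟫ - ⟪v, v⟫ = 2 * (k : ℝ)}

/-- `CharSign Λ ε` (for `ε = ±1`): characteristic covectors with `ξ·ξ ≡ n + ε (mod 8)`. -/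
def CharSign {n : ℕ} (Λ : Set (EuclideanSpace ℝ (Fin n))) (ε : ℤ) :
    Set (EuclideanSpace ℝ (Fin n)) :=
  {ξ | ξ ∈ CharSet Λ ∧ ∃ k : ℤ, ⟪ξ, ξ⟫ = (n : ℝ) + (ε : ℝ) + 8 * (k : ℝ)}

/-- The defect `d(Λ) = min_{ξ ∈ Char(Λ)} (ξ·ξ − n)/4` of a full-rank lattice in `ℝ^n`. -/
def defect {n : ℕ} (Λ : Set (EuclideanSpace ℝ (Fin n))) : ℝ :=
  sInf ((fun ξ => (⟪ξ, ξ⟫ - (n : ℝ)) / 4) '' CharSet Λ)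

/-- The two defects `d_±(L) = min_{ξ ∈ Char_±(L)} (ξ·ξ − n)/4` of a bimodular lattice. -/
def defectSign {n : ℕ} (Λ : Set (EuclideanSpace ℝ (Fin n))) (ε : ℤ) : ℝ :=
  sInf ((fun ξ => (⟪ξ, ξ⟫ - (n : ℝ)) / 4) '' CharSign Λ ε)

/-- The juxtaposition `(x, y) ∈ ℝ^n × ℝ^m = ℝ^{n+m}`. -/
def pairE {n m : ℕ} (x : EuclideanSpace ℝ (Fin n)) (y : EuclideanSpace ℝ (Fin m)) :
    EuclideanSpace ℝ (Fin (n + m)) :=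
  (EuclideanSpace.equiv (Fin (n + m)) ℝ).symm
    (Fin.append (EuclideanSpace.equiv (Fin n) ℝ x) (EuclideanSpace.equiv (Fin m) ℝ y))

/-- The first component `ℝ^{n+m} → ℝ^n` of a covector. -/
def restFst {n m : ℕ} (ξ : EuclideanSpace ℝ (Fin (n + m))) : EuclideanSpace ℝ (Fin n) :=
  (EuclideanSpace.equiv (Fin n) ℝ).symm
    (fun i => EuclideanSpace.equiv (Fin (n + m)) ℝ ξ (Fin.castAdd m i))

/-- The second component `ℝ^{n+m} → ℝ^m` of a covector. -/
def restSnd {n m : ℕ} (ξ : EuclideanSpace ℝ (Fin (n + m))) : EuclideanSpace ℝ (Fin m) :=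
  (EuclideanSpace.equiv (Fin m) ℝ).symm
    (fun i => EuclideanSpace.equiv (Fin (n + m)) ℝ ξ (Fin.natAdd n i))

/-- The orthogonal direct sum `L ⊕ A ⊂ ℝ^{n+m}`, i.e. the subgroup `L × A`. -/
def prodSet {n m : ℕ} (L : Set (EuclideanSpace ℝ (Fin n))) (A : Set (EuclideanSpace ℝ (Fin m))) :
    Set (EuclideanSpace ℝ (Fin (n + m))) :=
  {z | ∃ x ∈ L, ∃ y ∈ A, z = pairE x y}

/-- The overlattice `U_A = (L × A) ∪ ((L' \ L) × (A' \ A)) ⊂ ℝ^{n+m}`. -/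
def overLattice {n m : ℕ} (L : Set (EuclideanSpace ℝ (Fin n)))
    (A : Set (EuclideanSpace ℝ (Fin m))) : Set (EuclideanSpace ℝ (Fin (n + m))) :=
  prodSet L A ∪ prodSet (dualSet L \ L) (dualSet A \ A)

/-- The standard lattice `I^n = ℤ^n ⊂ ℝ^n`. -/
def stdLattice (n : ℕ) : Set (EuclideanSpace ℝ (Fin n)) :=
  {x | ∀ i : Fin n, ∃ k : ℤ, x i = (k : ℝ)}

/-- A lattice is diagonal if it admits a `ℤ`-basis with Gram matrix `diag(1, …, 1, 2)`,
i.e. it is isomorphic to `Δ_n = I^{n-1} ⊕ A_1`. -/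
def IsDiagonal {n : ℕ} (Λ : Set (EuclideanSpace ℝ (Fin n))) : Prop :=
  ∃ b : Fin n → EuclideanSpace ℝ (Fin n),
    (∀ i, b i ∈ Λ) ∧ LinearIndependent ℤ b ∧
    (∀ x ∈ Λ, ∃ c : Fin n → ℤ, x = ∑ i, (c i : ℝ) • b i) ∧
    (∀ i j : Fin n, ⟪b i, b j⟫ =
      if i = j then (if (i : ℕ) = n - 1 then 2 else 1) else 0)

/-- A lattice has an orthonormal `ℤ`-basis iff it is isomorphic to the standard lattice `I^n`. -/
def HasOrthonormalZBasis {n : ℕ} (Λ : Set (EuclideanSpace ℝ (Fin n))) : Prop :=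
  ∃ b : Fin n → EuclideanSpace ℝ (Fin n),
    (∀ i, b i ∈ Λ) ∧ LinearIndependent ℤ b ∧
    (∀ x ∈ Λ, ∃ c : Fin n → ℤ, x = ∑ i, (c i : ℝ) • b i) ∧
    (∀ i j : Fin n, ⟪b i, b j⟫ = if i = j then 1 else 0)

/-- The quadratic phase `n ↦ exp (π i n² / a)`. -/
def quadPhase (a : ℕ) (n : ℤ) : ℂ := Complex.exp (Real.pi * Complex.I * n ^ 2 / a)

lemma quadPhase_periodic {a : ℕ} (ha : Even a) : Function.Periodic (quadPhase a) (a : ℤ) := by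
  intro n
  obtain ⟨b, rfl⟩ := ha
  rcases Nat.eq_zero_or_pos b with rfl | hb
  · simp [quadPhase]
  have hb' : (b : ℂ) ≠ 0 := by exact_mod_cast hb.ne'
  have h2 : ((b : ℂ) + b) ≠ 0 := by rw [← two_mul]; simpa using hb'
  unfold quadPhase
  rw [Complex.exp_eq_exp_iff_exists_int]
  refine ⟨n + b, ?_⟩
  push_cast
  field_simp
  ring

lemma summable_quadPhase_term {τ : ℂ} (hτ : 0 < τ.im) :
    Summable fun n : ℤ => Complex.exp (Real.pi * Complex.I * (n : ℂ) ^ 2 * τ) := by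
  have := (hasSum_jacobiTheta₂_term 0 hτ).summable
  simpa [jacobiTheta₂_term] using this

lemma jacobiTheta_near_rational {a : ℕ} (ha : Even a) (ha0 : 0 < a) {t : ℝ} (ht : 0 < t) :
    jacobiTheta (1 / a + Complex.I / (a ^ 2 * t)) =
      (t ^ (1 / 2 : ℝ) : ℝ) * ∑ j ∈ Finset.range a,
        quadPhase a j * (HurwitzZeta.cosKernel ((j / a : ℝ) : UnitAddCircle) t : ℝ) := by
  have : NeZero a := ⟨ha0.ne'⟩
  have haC : (a : ℂ) ≠ 0 := by exact_mod_cast ha0.ne'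
  have htC : (t : ℂ) ≠ 0 := by exact_mod_cast ht.ne'
  have him : 0 < (1 / a + Complex.I / (a ^ 2 * t) : ℂ).im := by
    have : (1 / a + Complex.I / (a ^ 2 * t) : ℂ)
        = ((1 / a : ℝ) : ℂ) + ((1 / (a ^ 2 * t) : ℝ) : ℂ) * Complex.I := by
      push_cast; ring
    rw [this]
    simp only [Complex.add_im, Complex.ofReal_im, Complex.mul_I_im, Complex.ofReal_re, zero_add]
    positivity
  have hs := (summable_quadPhase_term him)
  have hterm (j : ℕ) : HasSum (fun k : ℤ => Complex.exp (Real.pi * Complex.I *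
      ((k * a + j : ℤ) : ℂ) ^ 2 * (1 / a + Complex.I / (a ^ 2 * t))))
      (quadPhase a j * (HurwitzZeta.evenKernel ((j / a : ℝ) : UnitAddCircle) (1 / t) : ℝ)) := by
    have h := HurwitzZeta.hasSum_int_evenKernel (j / a : ℝ) (one_div_pos.2 ht)
    rw [← Complex.hasSum_ofReal] at h
    refine (h.mul_left (quadPhase a j)).congr_fun fun k => ?_
    have hp : quadPhase a j = quadPhase a (k * a + j) := by
      rw [add_comm]; exact ((quadPhase_periodic ha).int_mul k j).symm
    rw [hp, quadPhase, Complex.ofReal_exp, ← Complex.exp_add]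
    congr 1
    push_cast
    field_simp
    ring_nf
    simp only [Complex.I_sq]
    ring
  rw [jacobiTheta, ← (Int.divModEquiv a).symm.tsum_eq]
  have hs' := (Int.divModEquiv a).symm.summable_iff.2 hs
  rw [← (Equiv.prodComm _ _).tsum_eq]
  have hs'' := (Equiv.prodComm (Fin a) ℤ).summable_iff.2 hs'
  refine (Summable.tsum_prod hs'').trans ?_
  simp only [Function.comp_def, Equiv.prodComm_apply, Prod.swap_prod_mk, Int.divModEquiv_symm_apply,
    tsum_fintype]
  rw [Finset.sum_congr rfl fun (j : Fin a) _ => (hterm j).tsum_eq,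
    Fin.sum_univ_eq_sum_range (fun j => quadPhase a j *
      ((HurwitzZeta.evenKernel ((j / a : ℝ) : UnitAddCircle) (1 / t) : ℝ) : ℂ)) a, Finset.mul_sum]
  refine Finset.sum_congr rfl fun j _ => ?_
  rw [HurwitzZeta.evenKernel_functional_equation, one_div_one_div, Real.div_rpow zero_le_one ht.le,
    Real.one_rpow, one_div_one_div]
  push_cast
  ring

lemma jacobiTheta_functional_equation (τ : ℂ) :
    jacobiTheta τ = 1 / (-Complex.I * τ) ^ (1 / 2 : ℂ) * jacobiTheta (-1 / τ) := by
  simp [jacobiTheta_eq_jacobiTheta₂, jacobiTheta₂_functional_equation 0 τ]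

lemma jacobiTheta_add_even {a : ℕ} (ha : Even a) (τ : ℂ) :
    jacobiTheta (a + τ) = jacobiTheta τ := by
  obtain ⟨b, rfl⟩ := ha
  induction b with
  | zero => simp
  | succ b ih =>
    rw [← ih, ← jacobiTheta_two_add (((b + b : ℕ) : ℂ) + τ)]
    congr 1
    push_cast
    ring

lemma jacobiTheta_near_rational' {a : ℕ} (ha : Even a) (ha0 : 0 < a) {t : ℝ} (ht : 0 < t) :
    jacobiTheta (1 / a + Complex.I / (a ^ 2 * t)) =
      (t ^ (1 / 2 : ℝ) : ℝ) *
      (1 / (-Complex.I * (1 / a + Complex.I / (a ^ 2 * t))) ^ (1 / 2 : ℂ) *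
        ((1 + Complex.I / (a * t)) ^ (1 / 2 : ℂ) * jacobiTheta (-1 / a + Complex.I * t))) := by
  have haC : (a : ℂ) ≠ 0 := by exact_mod_cast ha0.ne'
  have htC : (t : ℂ) ≠ 0 := by exact_mod_cast ht.ne'
  have haR : (0 : ℝ) < a := by exact_mod_cast ha0
  have hre : (1 + Complex.I / (a * t) : ℂ) = ((1 : ℝ) : ℂ) + ((1 / (a * t) : ℝ) : ℂ) * Complex.I := by
    push_cast; ring
  have hne : (1 + Complex.I / (a * t) : ℂ) ≠ 0 := by
    rw [hre]; intro h; simpa using congrArg Complex.re h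
  have hre' : (t * (1 + Complex.I / (a * t)) : ℂ) = (t : ℂ) + ((1 / a : ℝ) : ℂ) * Complex.I := by
    push_cast; field_simp
  have harg : (t * (1 + Complex.I / (a * t)) : ℂ).arg ≠ Real.pi := by
    rw [Ne, Complex.arg_eq_pi_iff, hre']
    simp [ht.le]
  have hI : Complex.I * (Complex.I) = -1 := Complex.I_mul_I
  have hne2 : (a * t + Complex.I : ℂ) ≠ 0 := by
    intro h; simpa using congrArg Complex.im h
  have hne3 : (1 - a * t * Complex.I : ℂ) ≠ 0 := by
    intro h; simpa using congrArg Complex.re h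
  rw [jacobiTheta_functional_equation, ← jacobiTheta_add_even ha, jacobiTheta_functional_equation
    (a + _)]
  have h1 : (a + -1 / (1 / a + Complex.I / (a ^ 2 * t)) : ℂ) = Complex.I * a / (a * t + Complex.I) := by
    have : (1 / a + Complex.I / (a ^ 2 * t) : ℂ) = (a * t + Complex.I) / (a ^ 2 * t) := by
      field_simp
    rw [this]
    field_simp
    ring
  have h2 : (-1 / (Complex.I * a / (a * t + Complex.I)) : ℂ) = -1 / a + Complex.I * t := by
    field_simp
    linear_combination (-a * t : ℂ) * hI
  have h3 : -Complex.I * (Complex.I * a / (a * t + Complex.I)) = (t * (1 + Complex.I / (a * t)))⁻¹ := by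
    field_simp
    linear_combination (-1) * hI
  rw [h1, h2, h3, Complex.inv_cpow _ _ harg, one_div (_⁻¹), inv_inv]
  have h4 : (t * (1 + Complex.I / (a * t)) : ℂ) ^ (1 / 2 : ℂ) =
      (t ^ (1 / 2 : ℝ) : ℝ) * (1 + Complex.I / (a * t)) ^ (1 / 2 : ℂ) := by
    rw [Complex.cpow_def_of_ne_zero (mul_ne_zero htC hne), Complex.log_ofReal_mul ht hne,
      Complex.ofReal_cpow ht.le, Complex.cpow_def_of_ne_zero htC, Complex.cpow_def_of_ne_zero hne,
      ← Complex.exp_add, Complex.ofReal_log ht.le]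
    congr 1
    push_cast
    ring
  rw [h4]
  ring

open Filter Topology in
/-- The quadratic Gauss sum of even modulus, including its argument. -/
theorem sum_quadPhase {a : ℕ} (ha : Even a) (ha0 : 0 < a) :
    ∑ j ∈ Finset.range a, quadPhase a j = (√a : ℝ) * Complex.exp (Real.pi * Complex.I / 4) := by
  have haC : (a : ℂ) ≠ 0 := by exact_mod_cast ha0.ne'
  have haR : (0 : ℝ) < a := by exact_mod_cast ha0
  have hinv : Tendsto (fun t : ℝ => ((t⁻¹ : ℝ) : ℂ)) atTop (𝓝 0) := by
    rw [← Complex.ofReal_zero]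
    exact (Complex.continuous_ofReal.tendsto 0).comp tendsto_inv_atTop_zero
  have hL : Tendsto (fun t : ℝ => ∑ j ∈ Finset.range a, quadPhase a j *
      ((HurwitzZeta.cosKernel ((j / a : ℝ) : UnitAddCircle) t : ℝ) : ℂ)) atTop
      (𝓝 (∑ j ∈ Finset.range a, quadPhase a j)) := by
    refine tendsto_finsetSum _ fun j _ => ?_
    obtain ⟨p, hp, hO⟩ := HurwitzZeta.isBigO_atTop_cosKernel_sub ((j / a : ℝ) : UnitAddCircle)
    have h0 : Tendsto (fun x : ℝ => Real.exp (-p * x)) atTop (𝓝 0) :=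
      Real.tendsto_exp_atBot.comp (tendsto_id.const_mul_atTop_of_neg (by linarith))
    have h1 := (hO.trans_tendsto h0).add_const 1
    simp only [sub_add_cancel, zero_add] at h1
    have h2 := ((Complex.continuous_ofReal.tendsto 1).comp h1).const_mul (quadPhase a j)
    simpa using h2
  have hR1 : Tendsto (fun t : ℝ => 1 / (-Complex.I * (1 / a + Complex.I / (a ^ 2 * t))) ^ (1 / 2 : ℂ))
      atTop (𝓝 (1 / (-Complex.I * (1 / a)) ^ (1 / 2 : ℂ))) := by
    have h0 : Tendsto (fun t : ℝ => (-Complex.I * (1 / a + Complex.I / (a ^ 2 * t)))) atTop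
        (𝓝 (-Complex.I * (1 / a))) := by
      have := ((hinv.const_mul (Complex.I / a ^ 2)).const_add (1 / (a : ℂ))).const_mul (-Complex.I)
      simp only [mul_zero, add_zero] at this
      refine this.congr fun t => ?_
      push_cast
      congr 2
      rw [← div_div]; rfl
    refine tendsto_const_nhds.div (h0.cpow tendsto_const_nhds ?_) ?_
    · right
      simp [ha0.ne']
    · rw [Ne, Complex.cpow_eq_zero_iff]
      simp [haC]
  have hR2 : Tendsto (fun t : ℝ => (1 + Complex.I / (a * t)) ^ (1 / 2 : ℂ)) atTop (𝓝 1) := by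
    have h0 : Tendsto (fun t : ℝ => (1 + Complex.I / (a * t))) atTop (𝓝 1) := by
      have := ((hinv.const_mul (Complex.I / a)).const_add (1 : ℂ))
      simp only [mul_zero, add_zero] at this
      refine this.congr fun t => ?_
      push_cast
      rw [← div_div]; rfl
    have := h0.cpow (tendsto_const_nhds (x := (1 / 2 : ℂ))) (by simp)
    simpa using this
  have hR3 : Tendsto (fun t : ℝ => jacobiTheta (-1 / a + Complex.I * t)) atTop (𝓝 1) := by
    have him (t : ℝ) : (-1 / a + Complex.I * t : ℂ).im = t := by
      have : (-1 / a + Complex.I * t : ℂ) = ((-1 / a : ℝ) : ℂ) + (t : ℂ) * Complex.I := by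
        push_cast; ring
      rw [this]; simp
    have hc : Tendsto (fun t : ℝ => (-1 / a + Complex.I * t : ℂ)) atTop (comap Complex.im atTop) := by
      rw [tendsto_comap_iff]
      exact tendsto_id.congr fun t => (him t).symm
    have hO := isBigO_at_im_infty_jacobiTheta_sub_one.comp_tendsto hc
    have h0 : Tendsto (fun x : ℝ => Real.exp (-Real.pi * x)) atTop (𝓝 0) :=
      Real.tendsto_exp_atBot.comp
        (tendsto_id.const_mul_atTop_of_neg (by linarith [Real.pi_pos]))
    have h1 := (hO.trans_tendsto (h0.congr fun t => by simp only [Function.comp, him])).add_const 1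
    simpa using h1
  have hlim := hR1.mul (hR2.mul hR3)
  have heq := tendsto_nhds_unique_of_eventuallyEq hL hlim (by
    filter_upwards [eventually_gt_atTop 0] with t ht
    have h := (jacobiTheta_near_rational ha ha0 ht).symm.trans (jacobiTheta_near_rational' ha ha0 ht)
    refine mul_left_cancel₀ ?_ h
    exact_mod_cast (Real.rpow_pos_of_pos ht _).ne')
  rw [heq, mul_one, mul_one]
  have hbase : (-Complex.I * (1 / a) : ℂ) = ((1 / a : ℝ) : ℂ) * (-Complex.I) := by
    push_cast; ring
  rw [hbase, Complex.cpow_def_of_ne_zero (by simp [haC]), one_div, ← Complex.exp_neg,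
    Complex.log_ofReal_mul (by positivity) (by simp), Complex.log_neg_I,
    Real.sqrt_eq_rpow, Real.rpow_def_of_pos haR, Complex.ofReal_exp, ← Complex.exp_add]
  congr 1
  rw [one_div, Real.log_inv]
  push_cast
  ring
lemma Function.Periodic.zmod_val {α : Type*} {a : ℕ} [NeZero a] {F : ℤ → α}
    (hF : Function.Periodic F (a : ℤ)) (z : ℤ) : F ((z : ZMod a).val : ℤ) = F z := by
  rw [ZMod.val_intCast]
  conv_rhs => rw [← Int.emod_add_mul_ediv z a, mul_comm]
  exact (hF.int_mul _ _).symm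

lemma ZMod.sum_val_eq_sum_range {α : Type*} [AddCommMonoid α] (a : ℕ) [NeZero a] (F : ℕ → α) :
    ∑ c : ZMod a, F c.val = ∑ j ∈ Finset.range a, F j := by
  cases a with
  | zero => exact absurd rfl (NeZero.ne 0)
  | succ a => exact Fin.sum_univ_eq_sum_range F (a + 1)

lemma Function.Periodic.sum_zmod_val_add {α : Type*} [AddCommMonoid α] {a : ℕ} [NeZero a]
    {F : ℤ → α} (hF : Function.Periodic F (a : ℤ)) (d : ℤ) :
    ∑ c : ZMod a, F (c.val + d) = ∑ j ∈ Finset.range a, F j := by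
  rw [← ZMod.sum_val_eq_sum_range a fun j => F j]
  refine Fintype.sum_equiv (Equiv.addRight (d : ZMod a)) _ _ fun c => ?_
  rw [← hF.zmod_val]
  simp

/-- If `f` restricted to each coset of `R` is a multiple of a character of `R`, then only the
cosets on which `f` is constant contribute to its sum. -/
lemma sum_eq_card_mul_of_char_on_cosets {Q : Type*} [AddCommGroup Q] [Fintype Q]
    (R : AddSubgroup Q) (f : Q → ℂ) (w : Q)
    (hf : ∀ x, ∀ y ∈ R, ∀ z ∈ R, f (x + y + z) * f x = f (x + y) * f (x + z))
    (hw : w ∉ R)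
    (hT : ∀ x, (∀ y ∈ R, f (x + y) = f x) ↔ x ∈ R ∨ x - w ∈ R) :
    ∃ N : ℕ, 0 < N ∧ ∑ x, f x = N * (f 0 + f w) := by
  classical
  have hN : 0 < Fintype.card R := Fintype.card_pos
  refine ⟨Fintype.card R, hN, ?_⟩
  have hNC : (Fintype.card R : ℂ) ≠ 0 := by exact_mod_cast hN.ne'
  have hcard (c : ℂ) : ∑ x, (if x ∈ R then c else 0) = Fintype.card R * c := by
    rw [← Finset.sum_filter, Finset.sum_const, ← Fintype.card_subtype, nsmul_eq_mul]
  have hin (x : Q) : ∑ y : R, f (x + y) = Fintype.card R *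
      ((if x ∈ R then f 0 else 0) + if x - w ∈ R then f w else 0) := by
    by_cases hx : ∀ y ∈ R, f (x + y) = f x
    · rw [Finset.sum_congr rfl fun (y : R) _ => hx y y.2, Finset.sum_const, Finset.card_univ,
        nsmul_eq_mul]
      congr 1
      rcases (hT x).1 hx with h | h
      · have h2 : x - w ∉ R := fun h2 => hw (by simpa using R.sub_mem h h2)
        have h0 := (hT 0).2 (Or.inl R.zero_mem) x h
        simp only [zero_add] at h0
        simp [h, h2, h0]
      · have h2 : x ∉ R := fun h2 => hw (by simpa using R.sub_mem h2 h)
        have h0 := (hT w).2 (Or.inr (by simp)) _ h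
        simp only [add_sub_cancel] at h0
        simp [h, h2, h0]
    · have hx' := mt (hT x).2 hx
      push Not at hx hx'
      simp only [hx'.1, hx'.2, if_false, add_zero, mul_zero]
      obtain ⟨y, hy, hne⟩ := hx
      have hshift : ∑ z : R, f (x + y + z) = ∑ z : R, f (x + z) := by
        exact Fintype.sum_equiv (Equiv.addLeft (⟨y, hy⟩ : R)) _ _ fun z => by simp [add_assoc]
      have h1 : (∑ z : R, f (x + z)) * f x = f (x + y) * ∑ z : R, f (x + z) := by
        rw [← hshift, Finset.sum_mul, hshift, Finset.mul_sum]
        exact Finset.sum_congr rfl fun z _ => hf x y hy z z.2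
      by_contra h0
      exact hne (mul_right_cancel₀ h0 (by rw [← h1, mul_comm]))
  have htot : ∑ x, ∑ y : R, f (x + y) = Fintype.card R * ∑ x, f x := by
    rw [Finset.sum_comm, Finset.sum_congr rfl fun (y : R) _ =>
      Fintype.sum_equiv (Equiv.addRight (y : Q)) (fun x => f (x + y)) f fun x => rfl]
    simp
  rw [Finset.sum_congr rfl fun x _ => hin x, ← Finset.mul_sum, Finset.sum_add_distrib, hcard,
    Fintype.sum_equiv (Equiv.subRight w) (fun x => if x - w ∈ R then f w else 0)
      (fun x => if x ∈ R then f w else 0) fun x => rfl, hcard, ← mul_add] at htot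
  exact (mul_left_cancel₀ hNC htot).symm

section lattice
variable {n : ℕ} {L : AddSubgroup (EuclideanSpace ℝ (Fin n))}

/-- If some nonzero integer multiples of `x` and `y` lie in the integral lattice `L`, then so does
a nonzero integer multiple of the projection of `y` to `x`. -/
lemma exists_zsmul_proj_mem (hint : ∀ v ∈ L, ∀ w ∈ L, ∃ k : ℤ, ⟪v, w⟫ = (k : ℝ))
    {x y : EuclideanSpace ℝ (Fin n)} (hx : ∃ D : ℤ, D ≠ 0 ∧ D • x ∈ L)
    (hy : ∃ D : ℤ, D ≠ 0 ∧ D • y ∈ L) :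
    ∃ D : ℤ, D ≠ 0 ∧ D • ((⟪x, y⟫ / ‖x‖ ^ 2) • x) ∈ L := by
  obtain ⟨D, hD, hDx⟩ := hx
  obtain ⟨E, hE, hEy⟩ := hy
  rcases eq_or_ne x 0 with rfl | hx0
  · exact ⟨1, one_ne_zero, by simp⟩
  obtain ⟨p, hp⟩ := hint _ hDx _ hEy
  obtain ⟨q, hq⟩ := hint _ hDx _ hDx
  simp only [← Int.cast_smul_eq_zsmul ℝ, real_inner_smul_left, real_inner_smul_right] at hp hq
  rw [real_inner_self_eq_norm_sq] at hq
  have hDR : (D : ℝ) ≠ 0 := by exact_mod_cast hD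
  have hER : (E : ℝ) ≠ 0 := by exact_mod_cast hE
  have hxR : ‖x‖ ≠ 0 := by simpa using hx0
  have hq0 : (q : ℝ) ≠ 0 := by rw [← hq]; positivity
  refine ⟨q * E, mul_ne_zero (by exact_mod_cast hq0) hE, ?_⟩
  have : (q * E) • ((⟪x, y⟫ / ‖x‖ ^ 2) • x) = p • (D • x) := by
    simp only [← Int.cast_smul_eq_zsmul ℝ, smul_smul]
    congr 1
    push_cast
    rw [← hp, ← hq]
    field_simp
  rw [this]
  exact L.zsmul_mem hDx p

lemma exists_zsmul_sum_mem {ι : Type*} (s : Finset ι) (f : ι → EuclideanSpace ℝ (Fin n))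
    (hf : ∀ i ∈ s, ∃ D : ℤ, D ≠ 0 ∧ D • f i ∈ L) : ∃ D : ℤ, D ≠ 0 ∧ D • ∑ i ∈ s, f i ∈ L := by
  classical
  induction s using Finset.induction_on with
  | empty => exact ⟨1, one_ne_zero, by simp⟩
  | insert i s hi ih =>
    obtain ⟨D, hD, hD'⟩ := ih fun j hj => hf j (Finset.mem_insert_of_mem hj)
    obtain ⟨E, hE, hE'⟩ := hf i (Finset.mem_insert_self _ _)
    refine ⟨D * E, mul_ne_zero hD hE, ?_⟩
    rw [Finset.sum_insert hi, smul_add, mul_smul, mul_comm D E, mul_smul]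
    exact L.add_mem (L.zsmul_mem hE' D) (L.zsmul_mem hD' E)

lemma exists_zsmul_gramSchmidt_mem (hint : ∀ v ∈ L, ∀ w ∈ L, ∃ k : ℤ, ⟪v, w⟫ = (k : ℝ))
    {b : Fin n → EuclideanSpace ℝ (Fin n)} (hb : ∀ i, b i ∈ L) (i : Fin n) :
    ∃ D : ℤ, D ≠ 0 ∧ D • InnerProductSpace.gramSchmidt ℝ b i ∈ L := by
  induction i using WellFoundedLT.induction with
  | ind i ih =>
    have hbi : ∃ D : ℤ, D ≠ 0 ∧ D • b i ∈ L := ⟨1, one_ne_zero, by simpa using hb i⟩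
    obtain ⟨D, hD, hD'⟩ := exists_zsmul_sum_mem (L := L) (Finset.Iio i)
      (fun j => (⟪InnerProductSpace.gramSchmidt ℝ b j, b i⟫ /
        ‖InnerProductSpace.gramSchmidt ℝ b j‖ ^ 2) • InnerProductSpace.gramSchmidt ℝ b j)
      fun j hj => exists_zsmul_proj_mem hint (ih j (Finset.mem_Iio.1 hj)) hbi
    refine ⟨D, hD, ?_⟩
    have h := InnerProductSpace.gramSchmidt_def'' ℝ b i
    rw [← sub_eq_iff_eq_add] at h
    rw [← h, smul_sub]
    exact L.sub_mem (L.zsmul_mem (hb i) D) hD'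

/-- An integral lattice of full rank contains an orthogonal family of full rank. -/
lemma exists_orthogonal_family_mem (hint : ∀ v ∈ L, ∀ w ∈ L, ∃ k : ℤ, ⟪v, w⟫ = (k : ℝ))
    {b : Fin n → EuclideanSpace ℝ (Fin n)} (hb : ∀ i, b i ∈ L) (hlin : LinearIndependent ℝ b) :
    ∃ g : Fin n → EuclideanSpace ℝ (Fin n), (∀ i, g i ∈ L) ∧ (∀ i, g i ≠ 0) ∧
      ∀ i j, i ≠ j → ⟪g i, g j⟫ = 0 := by
  choose D hD hDL using exists_zsmul_gramSchmidt_mem hint hb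
  refine ⟨fun i => D i • InnerProductSpace.gramSchmidt ℝ b i, hDL, fun i => ?_, fun i j hij => ?_⟩
  · beta_reduce
    rw [← Int.cast_smul_eq_zsmul ℝ]
    exact smul_ne_zero (Int.cast_ne_zero.2 (hD i)) (InnerProductSpace.gramSchmidt_ne_zero i hlin)
  simp only [← Int.cast_smul_eq_zsmul ℝ, real_inner_smul_left, real_inner_smul_right,
    InnerProductSpace.gramSchmidt_orthogonal ℝ b hij, mul_zero]

end lattice
section orthogonalCoordinates
variable {n : ℕ} {a : Fin n → ℕ} {m : Fin n → EuclideanSpace ℝ (Fin n)}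

/-- The vector whose scalar products with the orthogonal vectors `m i`, of square lengths `a i`,
are the integers `j i`. -/
def vecOfPairings (a : Fin n → ℕ) (m : Fin n → EuclideanSpace ℝ (Fin n)) (j : Fin n → ℤ) :
    EuclideanSpace ℝ (Fin n) :=
  ∑ i, ((j i : ℝ) / a i) • m i

lemma vecOfPairings_add (j k : Fin n → ℤ) :
    vecOfPairings a m (j + k) = vecOfPairings a m j + vecOfPairings a m k := by
  simp [vecOfPairings, add_div, add_smul, Finset.sum_add_distrib]

lemma vecOfPairings_sub (j k : Fin n → ℤ) :
    vecOfPairings a m (j - k) = vecOfPairings a m j - vecOfPairings a m k := by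
  simp [vecOfPairings, sub_div, sub_smul, Finset.sum_sub_distrib]

lemma inner_vecOfPairings (ha : ∀ i, 0 < a i)
    (hm : ∀ i j, ⟪m i, m j⟫ = if i = j then (a i : ℝ) else 0) (j : Fin n → ℤ) (i : Fin n) :
    ⟪vecOfPairings a m j, m i⟫ = j i := by
  have : (a i : ℝ) ≠ 0 := by exact_mod_cast (ha i).ne'
  simp [vecOfPairings, sum_inner, real_inner_smul_left, hm, this]

lemma inner_vecOfPairings_vecOfPairings (ha : ∀ i, 0 < a i)
    (hm : ∀ i j, ⟪m i, m j⟫ = if i = j then (a i : ℝ) else 0) (j k : Fin n → ℤ) :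
    ⟪vecOfPairings a m j, vecOfPairings a m k⟫ = ∑ i, (j i : ℝ) * k i / a i := by
  conv_lhs => rw [vecOfPairings.eq_def a m k, inner_sum]
  refine Finset.sum_congr rfl fun i _ => ?_
  rw [real_inner_smul_right, inner_vecOfPairings ha hm]
  ring

lemma eq_vecOfPairings (ha : ∀ i, 0 < a i)
    (hm : ∀ i j, ⟪m i, m j⟫ = if i = j then (a i : ℝ) else 0) {v : EuclideanSpace ℝ (Fin n)}
    {j : Fin n → ℤ} (hv : ∀ i, ⟪v, m i⟫ = j i) : v = vecOfPairings a m j := by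
  have hm0 (i : Fin n) : m i ≠ 0 := by
    intro h
    have := hm i i
    simp only [h, inner_zero_left, if_true] at this
    exact (ha i).ne (by exact_mod_cast this)
  have hlin : LinearIndependent ℝ m :=
    linearIndependent_of_ne_zero_of_inner_eq_zero hm0 fun i k hik => by simp [hm, hik]
  refine InnerProductSpace.ext_inner_right_basis
    (basisOfLinearIndependentOfCardEqFinrank' m hlin (by simp)) fun i => ?_
  simp [hv, inner_vecOfPairings ha hm]

/-- Vectors whose pairings agree modulo the `a i` differ by an integral combination of the `m i`. -/
lemma vecOfPairings_sub_mem {L : AddSubgroup (EuclideanSpace ℝ (Fin n))} (ha : ∀ i, 0 < a i)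
    (hmL : ∀ i, m i ∈ L) {j k : Fin n → ℤ} (hjk : ∀ i, (j i : ZMod (a i)) = k i) :
    vecOfPairings a m j - vecOfPairings a m k ∈ L := by
  rw [← vecOfPairings_sub]
  refine L.sum_mem fun i _ => ?_
  obtain ⟨c, hc⟩ := (ZMod.intCast_eq_intCast_iff_dvd_sub _ _ _).1 (hjk i).symm
  have : (a i : ℝ) ≠ 0 := by exact_mod_cast (ha i).ne'
  have hc' : (((j - k) i : ℤ) : ℝ) / a i = c := by
    rw [Pi.sub_apply, hc]
    push_cast
    field_simp
  rw [hc', Int.cast_smul_eq_zsmul]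
  exact L.zsmul_mem (hmL i) c

end orthogonalCoordinates

/-- The phase `exp (π i |x + ξ/2|²)`. -/
def vecPhase {n : ℕ} (ξ x : EuclideanSpace ℝ (Fin n)) : ℂ :=
  Complex.exp (Real.pi * Complex.I * ((⟪x, x⟫ + ⟪ξ, x⟫ + ⟪ξ, ξ⟫ / 4 : ℝ) : ℂ))

lemma vecPhase_eq_prod {n : ℕ} {a : Fin n → ℕ} {m : Fin n → EuclideanSpace ℝ (Fin n)}
    (ha : ∀ i, 0 < a i) (hm : ∀ i j, ⟪m i, m j⟫ = if i = j then (a i : ℝ) else 0)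
    {ξ : EuclideanSpace ℝ (Fin n)} {d : Fin n → ℤ} (hd : ∀ i, ⟪ξ, m i⟫ = (2 * d i : ℤ))
    (j : Fin n → ℤ) :
    vecPhase ξ (vecOfPairings a m j) = ∏ i, quadPhase (a i) (j i + d i) := by
  have hξ : ξ = vecOfPairings a m fun i => 2 * d i := eq_vecOfPairings ha hm hd
  unfold vecPhase quadPhase
  rw [hξ, ← Complex.exp_sum]
  simp only [inner_vecOfPairings_vecOfPairings ha hm]
  congr 1
  rw [Finset.sum_div, ← Finset.sum_add_distrib, ← Finset.sum_add_distrib, Complex.ofReal_sum,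
    Finset.mul_sum]
  refine Finset.sum_congr rfl fun i _ => ?_
  have : (a i : ℂ) ≠ 0 := by exact_mod_cast (ha i).ne'
  push_cast
  field_simp
  ring

lemma exp_pi_mul_I_mul_two_mul_eq_one_iff (r : ℝ) :
    Complex.exp (Real.pi * Complex.I * ((2 * r : ℝ) : ℂ)) = 1 ↔ ∃ k : ℤ, r = k := by
  rw [Complex.exp_eq_one_iff]
  have h2 : (2 * Real.pi * Complex.I : ℂ) ≠ 0 := Complex.two_pi_I_ne_zero
  refine exists_congr fun k => ⟨fun h => ?_, fun h => ?_⟩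
  · have : (r : ℂ) = k := mul_left_cancel₀ h2 (by push_cast at h; linear_combination h)
    exact_mod_cast this
  · rw [h]; push_cast; ring

/-- Milgram's formula, up to a positive factor, for a lattice `L` of index two in its dual
`L ∪ (L + w)`. -/
lemma exists_pos_mul_exp_eq_vecPhase_add {n : ℕ} {L : AddSubgroup (EuclideanSpace ℝ (Fin n))}
    (hint : ∀ v ∈ L, ∀ w ∈ L, ∃ k : ℤ, ⟪v, w⟫ = (k : ℝ))
    {g : Fin n → EuclideanSpace ℝ (Fin n)} (hgL : ∀ i, g i ∈ L) (hg0 : ∀ i, g i ≠ 0)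
    (hg : ∀ i j, i ≠ j → ⟪g i, g j⟫ = 0) {ξ w : EuclideanSpace ℝ (Fin n)}
    (hξ : ∀ v ∈ L, ∃ k : ℤ, ⟪ξ, v⟫ = (k : ℝ))
    (hξ2 : ∀ v ∈ L, ∃ k : ℤ, ⟪ξ, v⟫ - ⟪v, v⟫ = 2 * (k : ℝ)) (hw : w ∉ L)
    (hdual : ∀ x, (∀ v ∈ L, ∃ k : ℤ, ⟪x, v⟫ = (k : ℝ)) ↔ x ∈ L ∨ x - w ∈ L) :
    ∃ r : ℝ, 0 < r ∧
      r * Complex.exp (Real.pi * Complex.I / 4 * n) = vecPhase ξ 0 + vecPhase ξ w := by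
  choose k hk using fun i => hint _ (hgL i) _ (hgL i)
  have hkpos (i : Fin n) : 0 < k i := by
    have : 0 < ⟪g i, g i⟫ := real_inner_self_pos.2 (hg0 i)
    rw [hk] at this
    exact_mod_cast this
  choose d hd' using fun i => hξ _ (hgL i)
  set m : Fin n → EuclideanSpace ℝ (Fin n) := fun i => (2 : ℝ) • g i with hmdef
  set a : Fin n → ℕ := fun i => 4 * (k i).toNat with hadef
  have ha (i : Fin n) : 0 < a i := by have := hkpos i; simp only [hadef]; omega
  have hae (i : Fin n) : Even (a i) := ⟨2 * (k i).toNat, by simp only [hadef]; ring⟩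
  have : ∀ i, NeZero (a i) := fun i => ⟨(ha i).ne'⟩
  have hm (i j : Fin n) : ⟪m i, m j⟫ = if i = j then (a i : ℝ) else 0 := by
    simp only [hmdef, real_inner_smul_left, real_inner_smul_right]
    split_ifs with h
    · subst h
      have h1 : ((k i).toNat : ℝ) = k i := by
        exact_mod_cast Int.toNat_of_nonneg (hkpos i).le
      rw [hk, hadef]
      push_cast
      rw [h1]
      ring
    · simp [hg i j h]
  have hmL (i : Fin n) : m i ∈ L := by
    simpa only [hmdef, two_smul] using L.add_mem (hgL i) (hgL i)
  have hd (i : Fin n) : ⟪ξ, m i⟫ = (2 * d i : ℤ) := by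
    simp [hmdef, real_inner_smul_right, hd']
  let X := vecOfPairings a m
  have hXd (v : EuclideanSpace ℝ (Fin n)) (hv : ∀ u ∈ L, ∃ k : ℤ, ⟪v, u⟫ = (k : ℝ)) :
      ∃ j, v = X j := by
    choose j hj using fun i => hv _ (hmL i)
    exact ⟨j, eq_vecOfPairings ha hm hj⟩
  let proj : (Fin n → ℤ) →+ (∀ i, ZMod (a i)) :=
    { toFun := fun j i => (j i : ZMod (a i))
      map_zero' := by ext; simp
      map_add' := fun j k => by ext; simp }
  have hproj (q : ∀ i, ZMod (a i)) : ∃ j, proj j = q :=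
    ⟨fun i => ((q i).val : ℤ), by ext i; simp [proj]⟩
  let f : (∀ i, ZMod (a i)) → ℂ := fun q => ∏ i, quadPhase (a i) ((q i).val + d i)
  have hf (j : Fin n → ℤ) : f (proj j) = vecPhase ξ (X j) := by
    rw [vecPhase_eq_prod ha hm hd]
    refine Finset.prod_congr rfl fun i _ => ?_
    have hper : Function.Periodic (fun z => quadPhase (a i) (z + d i)) (a i : ℤ) := fun z => by
      beta_reduce
      rw [add_right_comm]
      exact quadPhase_periodic (hae i) _
    exact hper.zmod_val (j i)
  let XHom : (Fin n → ℤ) →+ EuclideanSpace ℝ (Fin n) := AddMonoidHom.mk' X vecOfPairings_add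
  let R : AddSubgroup (∀ i, ZMod (a i)) := (L.comap XHom).map proj
  have hR (j : Fin n → ℤ) : proj j ∈ R ↔ X j ∈ L := by
    constructor
    · rintro ⟨l, hl, hlj⟩
      have hl' : X l ∈ L := hl
      have := L.add_mem (vecOfPairings_sub_mem (m := m) ha hmL fun i => congrFun hlj.symm i) hl'
      simpa [X] using this
    · exact fun h => ⟨j, h, rfl⟩
  obtain ⟨jw, hjw⟩ := hXd w ((hdual w).2 (Or.inr (by simp)))
  have hshift (x v : EuclideanSpace ℝ (Fin n)) (hv : v ∈ L) : vecPhase ξ (x + v) =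
      vecPhase ξ x * Complex.exp (Real.pi * Complex.I * ((2 * ⟪x, v⟫ : ℝ) : ℂ)) := by
    obtain ⟨p, hp⟩ := hξ2 v hv
    obtain ⟨q, hq⟩ := hint v hv v hv
    have h1 := (exp_pi_mul_I_mul_two_mul_eq_one_iff (p + q)).2 ⟨p + q, by push_cast; rfl⟩
    rw [vecPhase, vecPhase, ← Complex.exp_add, ← mul_one (Complex.exp (_ + _)), ← h1,
      ← Complex.exp_add]
    congr 1
    rw [← mul_add, ← mul_add, ← Complex.ofReal_add, ← Complex.ofReal_add]
    congr 2
    rw [inner_add_left, inner_add_right, inner_add_right, inner_add_right, real_inner_comm x v]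
    linarith
  have hP0 (x : EuclideanSpace ℝ (Fin n)) : vecPhase ξ x ≠ 0 := Complex.exp_ne_zero _
  have hmain := sum_eq_card_mul_of_char_on_cosets R f (proj jw) ?_ ?_ ?_
  · obtain ⟨N, hN, hsum⟩ := hmain
    have hprod : ∑ q, f q = ∏ i, ((√(a i) : ℝ) * Complex.exp (Real.pi * Complex.I / 4)) := by
      simp only [f]
      rw [← Fintype.prod_sum fun i (c : ZMod (a i)) => quadPhase (a i) (c.val + d i)]
      refine Finset.prod_congr rfl fun i _ => ?_
      rw [(quadPhase_periodic (hae i)).sum_zmod_val_add, sum_quadPhase (hae i) (ha i)]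
    have h0 : f 0 = vecPhase ξ 0 := by
      have := hf 0
      simpa [X, vecOfPairings] using this
    rw [hprod, hf, ← hjw, h0, Finset.prod_mul_distrib, Finset.prod_const, Finset.card_univ,
      Fintype.card_fin, ← Complex.exp_nat_mul, ← Complex.ofReal_prod] at hsum
    have hNC : (N : ℂ) ≠ 0 := by exact_mod_cast hN.ne'
    refine ⟨(∏ i, √(a i)) / N, div_pos (Finset.prod_pos fun i _ => Real.sqrt_pos.2
      (by exact_mod_cast ha i)) (by exact_mod_cast hN), mul_left_cancel₀ hNC ?_⟩
    rw [← hsum]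
    push_cast
    field_simp
  · intro x y hy z hz
    obtain ⟨j, rfl⟩ := hproj x
    obtain ⟨y, hy, rfl⟩ := hy
    obtain ⟨z, hz, rfl⟩ := hz
    have hy' : X y ∈ L := hy
    have hz' : X z ∈ L := hz
    rw [← map_add, ← map_add, ← map_add, hf, hf, hf, hf]
    simp only [X, vecOfPairings_add]
    obtain ⟨p, hp⟩ := hint _ hy' _ hz'
    have h1 := (exp_pi_mul_I_mul_two_mul_eq_one_iff _).2 ⟨p, hp⟩
    rw [hshift _ _ hz', hshift _ _ hy', hshift _ _ hz', inner_add_left, mul_add (2 : ℝ),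
      Complex.ofReal_add, mul_add, Complex.exp_add, h1]
    ring
  · rw [hR, ← hjw]
    exact hw
  · intro x
    obtain ⟨j, rfl⟩ := hproj x
    rw [← map_sub, hR, hR]
    simp only [X, vecOfPairings_sub]
    rw [← show w = vecOfPairings a m jw from hjw, ← hdual]
    have hiff (v : EuclideanSpace ℝ (Fin n)) (hv : v ∈ L) :
        vecPhase ξ (X j + v) = vecPhase ξ (X j) ↔ ∃ k : ℤ, ⟪X j, v⟫ = (k : ℝ) := by
      rw [hshift _ _ hv, mul_eq_left₀ (hP0 _), exp_pi_mul_I_mul_two_mul_eq_one_iff]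
    constructor
    · intro h v hv
      obtain ⟨l, rfl⟩ := hXd v (hint v hv)
      have := h (proj l) ((hR l).2 hv)
      rw [← map_add, hf, hf] at this
      simp only [X, vecOfPairings_add] at this
      exact (hiff _ hv).1 this
    · rintro h y ⟨l, hl, rfl⟩
      have hl' : X l ∈ L := hl
      rw [← map_add, hf, hf]
      simp only [X, vecOfPairings_add]
      exact (hiff _ hl').2 (h _ hl')

/-- A lattice with a `ℤ`-basis that is a real basis is equal to its double dual. -/
lemma mem_of_inner_dual_int {n : ℕ} {L : AddSubgroup (EuclideanSpace ℝ (Fin n))}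
    {b : Fin n → EuclideanSpace ℝ (Fin n)} (hb : ∀ i, b i ∈ L) (hlin : LinearIndependent ℝ b)
    (hcoord : ∀ x ∈ L, ∃ c : Fin n → ℤ, x = ∑ i, (c i : ℝ) • b i) {w : EuclideanSpace ℝ (Fin n)}
    (hw : ∀ x, (∀ v ∈ L, ∃ k : ℤ, ⟪x, v⟫ = (k : ℝ)) → ∃ k : ℤ, ⟪w, x⟫ = (k : ℝ)) : w ∈ L := by
  let B := basisOfLinearIndependentOfCardEqFinrank' b hlin (by simp)
  have hB (i : Fin n) : B i = b i := by simp [B]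
  let e (i : Fin n) : EuclideanSpace ℝ (Fin n) :=
    (InnerProductSpace.toDual ℝ _).symm (LinearMap.toContinuousLinearMap (B.coord i))
  have he (i : Fin n) (x : EuclideanSpace ℝ (Fin n)) : ⟪e i, x⟫ = B.repr x i := by
    simp [e]
  have hint (i : Fin n) : ∃ k : ℤ, B.repr w i = (k : ℝ) := by
    obtain ⟨k, hk⟩ := hw (e i) fun v hv => by
      obtain ⟨c, rfl⟩ := hcoord v hv
      refine ⟨c i, ?_⟩
      rw [he]
      simp only [← hB]
      exact congrFun (B.repr_sum_self fun i => (c i : ℝ)) i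
    exact ⟨k, by rw [← hk, real_inner_comm, he]⟩
  choose k hk using hint
  rw [← B.sum_repr w]
  refine L.sum_mem fun i _ => ?_
  rw [hk, hB, Int.cast_smul_eq_zsmul]
  exact L.zsmul_mem (hb i) _

lemma real_eq_of_pos_mul_exp_eq {r s θ φ : ℝ} (hr : 0 < r) (hs : 0 < s)
    (h : r * Complex.exp (θ * Complex.I) = s * Complex.exp (φ * Complex.I)) :
    ∃ k : ℤ, θ = φ + k * (2 * Real.pi) := by
  have hn := congrArg norm h
  simp only [norm_mul, Complex.norm_exp_ofReal_mul_I, Complex.norm_real, Real.norm_eq_abs,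
    abs_of_pos hr, abs_of_pos hs, mul_one] at hn
  have hsC : (s : ℂ) ≠ 0 := by exact_mod_cast hs.ne'
  rw [hn] at h
  obtain ⟨k, hk⟩ := Complex.exp_eq_exp_iff_exists_int.1 (mul_left_cancel₀ hsC h)
  refine ⟨k, ?_⟩
  have : (θ : ℂ) = φ + k * (2 * Real.pi) :=
    mul_right_cancel₀ Complex.I_ne_zero (by linear_combination hk)
  exact_mod_cast this

/-- If `|w|² + ξ·w` is half an odd integer, the two phases add up to a positive multiple of an
eighth root of unity times `exp (π i |ξ|² / 4)`. -/
lemma vecPhase_zero_add {n : ℕ} {ξ w : EuclideanSpace ℝ (Fin n)} {h : ℤ}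
    (hw : ⟪w, w⟫ + ⟪ξ, w⟫ = (h : ℝ) + 1 / 2) :
    ∃ ε : ℤ, (ε = 1 ∨ ε = -1) ∧ vecPhase ξ 0 + vecPhase ξ w =
      (√2 : ℝ) * Complex.exp (((⟪ξ, ξ⟫ + ε) * (Real.pi / 4) : ℝ) * Complex.I) := by
  have hP0 : vecPhase ξ 0 = Complex.exp ((⟪ξ, ξ⟫ * (Real.pi / 4) : ℝ) * Complex.I) := by
    simp only [vecPhase, inner_zero_right, zero_add]
    congr 1
    push_cast
    ring
  have hquarter (ε : ℤ) (hε : ε = 1 ∨ ε = -1) :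
      (1 + ε * Complex.I : ℂ) = (√2 : ℝ) * Complex.exp ((ε * (Real.pi / 4) : ℝ) * Complex.I) := by
    have h2 : ((√2 : ℝ) : ℂ) * (√2 : ℝ) = 2 := by
      exact_mod_cast Real.mul_self_sqrt (by norm_num : (0 : ℝ) ≤ 2)
    rw [Complex.exp_mul_I, ← Complex.ofReal_cos, ← Complex.ofReal_sin]
    rcases hε with rfl | rfl
    · simp only [Int.cast_one, one_mul, Real.cos_pi_div_four, Real.sin_pi_div_four]
      push_cast
      linear_combination (-(1 + Complex.I) / 2) * h2
    · simp only [Int.cast_neg, Int.cast_one, neg_mul, one_mul, Real.cos_neg, Real.sin_neg,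
        Real.cos_pi_div_four, Real.sin_pi_div_four]
      push_cast
      linear_combination (-(1 - Complex.I) / 2) * h2
  have hPw : vecPhase ξ w = vecPhase ξ 0 * ((-1) ^ h * Complex.I) := by
    have h1 : ((-1 : ℂ)) ^ h * Complex.I =
        Complex.exp (Real.pi * Complex.I * ((h : ℝ) + 1 / 2 : ℝ)) := by
      push_cast
      rw [mul_add, Complex.exp_add, mul_comm _ (h : ℂ), Complex.exp_int_mul, Complex.exp_pi_mul_I,
        mul_one_div, mul_div_right_comm, Complex.exp_pi_div_two_mul_I]
    rw [h1, ← hw, vecPhase, vecPhase, ← Complex.exp_add]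
    congr 1
    simp
    ring
  obtain ⟨ε, hε, hεh⟩ : ∃ ε : ℤ, (ε = 1 ∨ ε = -1) ∧ ((-1 : ℂ)) ^ h = ε := by
    rcases Int.even_or_odd h with h' | h'
    · exact ⟨1, Or.inl rfl, by simp [h'.neg_one_zpow]⟩
    · exact ⟨-1, Or.inr rfl, by simp [h'.neg_one_zpow]⟩
  refine ⟨ε, hε, ?_⟩
  rw [hPw, hεh, ← mul_one_add, hquarter ε hε, hP0, mul_left_comm, ← Complex.exp_add, add_mul]
  congr 2
  push_cast
  ring

/-- if `L ⊂ ℝ^n` is bimodular and `ξ ∈ Char(L)`, then `ξ·ξ` is an integer and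
`ξ·ξ ≡ n + 1 (mod 8)` or `ξ·ξ ≡ n − 1 (mod 8)`. -/
theorem stmt2 {n : ℕ} (L : Set (EuclideanSpace ℝ (Fin n))) (hL : IsBimodular L)
    (ξ : EuclideanSpace ℝ (Fin n)) (hξ : ξ ∈ CharSet L) :
    (∃ k : ℤ, ⟪ξ, ξ⟫ = (k : ℝ)) ∧
    ((∃ k : ℤ, ⟪ξ, ξ⟫ = (n : ℝ) + 1 + 8 * (k : ℝ)) ∨
     (∃ k : ℤ, ⟪ξ, ξ⟫ = (n : ℝ) - 1 + 8 * (k : ℝ))) := by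
  obtain ⟨⟨⟨hzero, hadd, hneg⟩, ⟨b, hb, -, hcoord⟩, hspan, hint⟩, w, ⟨hwdual, hwL⟩, hcoset⟩ := hL
  obtain ⟨hξ, hξ2⟩ := hξ
  let Λ : AddSubgroup (EuclideanSpace ℝ (Fin n)) :=
    { carrier := L, add_mem' := fun {x y} hx hy => hadd x hx y hy, zero_mem' := hzero,
      neg_mem' := fun {x} hx => hneg x hx }
  have hlin : LinearIndependent ℝ b := by
    refine linearIndependent_of_top_le_span_of_card_eq_finrank ?_ (by simp)
    rw [← hspan, Submodule.span_le]
    intro x hx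
    obtain ⟨c, rfl⟩ := hcoord x hx
    exact Submodule.sum_mem _ fun i _ =>
      Submodule.smul_mem _ _ (Submodule.subset_span (Set.mem_range_self i))
  have hdual (x : EuclideanSpace ℝ (Fin n)) :
      (∀ v ∈ Λ, ∃ k : ℤ, ⟪x, v⟫ = (k : ℝ)) ↔ x ∈ Λ ∨ x - w ∈ Λ := by
    refine ⟨hcoset x, ?_⟩
    rintro (h | h) v hv
    · exact hint x h v hv
    · obtain ⟨p, hp⟩ := hint _ h v hv
      obtain ⟨q, hq⟩ := hwdual v hv
      exact ⟨p + q, by rw [← sub_add_cancel x w, inner_add_left, hp, hq]; push_cast; rfl⟩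
  have h2w : w + w ∈ Λ := by
    have h : ∀ v ∈ Λ, ∃ k : ℤ, ⟪w + w, v⟫ = (k : ℝ) := fun v hv => by
      obtain ⟨q, hq⟩ := hwdual v hv
      exact ⟨q + q, by rw [inner_add_left, hq]; push_cast; rfl⟩
    refine ((hdual _).1 h).resolve_right fun h' => hwL ?_
    rwa [add_sub_cancel_right] at h'
  obtain ⟨p, hp⟩ := hwdual _ h2w
  obtain ⟨q, hq⟩ := hξ2 _ h2w
  rw [inner_add_right] at hp
  have hξw : ⟪ξ, w⟫ = ((p + q : ℤ) : ℝ) := by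
    rw [inner_add_right, inner_add_right, inner_add_left] at hq
    push_cast
    linarith
  have hww : ¬ ∃ k : ℤ, ⟪w, w⟫ = (k : ℝ) := by
    rintro ⟨k, hk⟩
    refine hwL (mem_of_inner_dual_int (L := Λ) hb hlin hcoord fun x hx => ?_)
    rcases (hdual x).1 hx with h | h
    · exact hwdual x h
    · obtain ⟨l, hl⟩ := hwdual _ h
      exact ⟨l + k, by rw [← sub_add_cancel x w, inner_add_right, hl, hk]; push_cast; rfl⟩
  obtain ⟨h, hh⟩ : ∃ h : ℤ, ⟪w, w⟫ + ⟪ξ, w⟫ = (h : ℝ) + 1 / 2 := by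
    rcases Int.even_or_odd' p with ⟨c, rfl | rfl⟩
    · exact absurd ⟨c, by push_cast at hp; linarith⟩ hww
    · refine ⟨c + (2 * c + 1 + q), ?_⟩
      push_cast at hp hξw ⊢
      linarith
  obtain ⟨g, hgL, hg0, hg⟩ := exists_orthogonal_family_mem (L := Λ) hint hb hlin
  obtain ⟨r, hr, hmil⟩ :=
    exists_pos_mul_exp_eq_vecPhase_add (L := Λ) hint hgL hg0 hg hξ hξ2 hwL hdual
  obtain ⟨ε, hε, hsum⟩ := vecPhase_zero_add hh
  have hangle : (Real.pi * Complex.I / 4 * n : ℂ) = ((n * (Real.pi / 4) : ℝ) : ℂ) * Complex.I := by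
    push_cast
    ring
  rw [hsum, hangle] at hmil
  obtain ⟨k, hk⟩ := real_eq_of_pos_mul_exp_eq hr (by positivity) hmil
  have hnorm : ⟪ξ, ξ⟫ = (n : ℝ) - ε - 8 * k :=
    mul_right_cancel₀ (b := Real.pi / 4) (by positivity) (by linear_combination -hk)
  refine ⟨⟨n - ε - 8 * k, by rw [hnorm]; push_cast; rfl⟩, ?_⟩
  rcases hε with rfl | rfl
  · exact Or.inr ⟨-k, by rw [hnorm]; push_cast; ring⟩
  · exact Or.inl ⟨-k, by rw [hnorm]; push_cast; ring⟩

end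
end

section
/- Let L ⊂ ℝ^n and A ⊂ ℝ^m be bimodular lattices and let U_A = (L × A) ∪ ((L' \ L) × (A' \ A)) ⊂ ℝ^{n+m} be the associated unimodular overlattice of L ⊕ A. An element ξ_u of the dual lattice U_A' is a characteristic covector of U_A if and only if there exists a sign s ∈ {+, −} such that the component of ξ_u in ℝ^n lies in Char_s(L) and the component of ξ_u in ℝ^m lies in Char_{−s}(A). -/
open scoped RealInnerProductSpace

noncomputable section

open Complex Filter Topology in
theorem tendsto_tsum_gaussian_character {W : ℝ → ℂ} (hW : Tendsto (fun x => (W x).re) atTop atTop)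
    (c : ℝ) :
    Tendsto (fun x => ∑' k : ℤ, cexp (-Real.pi * W x * k ^ 2 - 2 * Real.pi * I * c * k))
      atTop (𝓝 1) := by
  have hnorm : ∀ x (k : ℤ), ‖cexp (-Real.pi * W x * k ^ 2 - 2 * Real.pi * I * c * k)‖
      = Real.exp (-Real.pi * ((W x).re * k ^ 2)) := by
    intro x k
    rw [Complex.norm_exp]
    congr 1
    rw [show -(Real.pi : ℂ) * W x * k ^ 2 - 2 * Real.pi * I * c * k
      = ((-Real.pi * k ^ 2 : ℝ) : ℂ) * W x + ((-(2 * Real.pi * c * k) : ℝ) : ℂ) * I by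
        push_cast; ring]
    rw [Complex.add_re, Complex.re_ofReal_mul, Complex.re_ofReal_mul, Complex.I_re]
    ring
  have h1 : ∑' k : ℤ, (if k = 0 then (1 : ℂ) else 0) = 1 := tsum_ite_eq 0 _
  rw [← h1]
  refine tendsto_tsum_of_dominated_convergence
    (bound := fun k : ℤ => Real.exp (-Real.pi * (1 * (k : ℝ) ^ 2 - 2 * 0 * |(k : ℝ)|))) ?_ ?_ ?_
  · simpa using summable_pow_mul_jacobiTheta₂_term_bound 0 one_pos 0
  · intro k
    split_ifs with hk
    · simp [hk]
    · rw [tendsto_zero_iff_norm_tendsto_zero]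
      simp_rw [hnorm]
      refine Real.tendsto_exp_atBot.comp ?_
      have hk2 : (0 : ℝ) < (k : ℝ) ^ 2 := by positivity
      exact (hW.atTop_mul_const hk2).const_mul_atTop_of_neg (neg_lt_zero.mpr Real.pi_pos)
  · filter_upwards [hW.eventually_ge_atTop 1] with x hx k
    rw [hnorm, Real.exp_le_exp]
    have hk2 : (0 : ℝ) ≤ (k : ℝ) ^ 2 := by positivity
    nlinarith [mul_le_mul_of_nonneg_right hx hk2, Real.pi_pos]

open Complex in
theorem tsum_shifted_gaussian {W : ℂ} (hW : 0 < W.re) (c : ℝ) :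
    ∑' k : ℤ, cexp (-Real.pi / W * (k + c) ^ 2) =
      W ^ (1 / 2 : ℂ) * ∑' k : ℤ, cexp (-Real.pi * W * k ^ 2 - 2 * Real.pi * I * c * k) := by
  have hW0 : W ≠ 0 := fun h => by simp [h] at hW
  have h := Complex.tsum_exp_neg_quadratic hW (-I * c)
  have hI : I * (-I * c) = c := by
    rw [← mul_assoc, mul_neg, I_mul_I]; ring
  simp_rw [hI] at h
  have hne : W ^ (1 / 2 : ℂ) ≠ 0 := by simp [Complex.cpow_eq_zero_iff, hW0]
  rw [one_div, eq_comm, inv_mul_eq_iff_eq_mul₀ hne] at h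
  rw [h]
  congr 1
  refine tsum_congr fun k => ?_
  congr 1
  ring

open Complex in
theorem tsum_gaussian_residue_classes {a : ℕ} [NeZero a] {b : ℤ} (hab : Even (b - a)) {t z : ℂ}
    (ht : z = t - I / a) (hz : 0 < z.re) :
    ∑' k : ℤ, cexp (-Real.pi * z * k ^ 2 + 2 * Real.pi * (I * b / (2 * a)) * k) =
      ∑ r : Fin a, cexp (Real.pi * I * ((r : ℕ) ^ 2 + b * (r : ℕ)) / a) *
        ∑' q : ℤ, cexp (-Real.pi * (a ^ 2 * t) * (q + ((r : ℕ) / a : ℝ)) ^ 2) := by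
  have ha : (a : ℂ) ≠ 0 := by exact_mod_cast NeZero.ne a
  have hsum : Summable fun k : ℤ =>
      cexp (-Real.pi * z * k ^ 2 + 2 * Real.pi * (I * b / (2 * a)) * k) := by
    have := (summable_jacobiTheta₂_term_iff ((b : ℂ) / (2 * a)) (I * z)).mpr (by simpa using hz)
    refine this.congr fun k => ?_
    rw [jacobiTheta₂_term]
    congr 1
    linear_combination (Real.pi * k ^ 2 * z) * I_mul_I
  rw [← (Int.divModEquiv a).symm.tsum_eq]
  have hsum' := (Int.divModEquiv a).symm.summable_iff.mpr hsum
  rw [← (Equiv.prodComm _ _).tsum_eq]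
  have hsum'' := (Equiv.prodComm (Fin a) ℤ).summable_iff.mpr hsum'
  refine hsum''.tsum_prod.trans ?_
  rw [tsum_fintype]
  refine Finset.sum_congr rfl fun r _ => ?_
  rw [← tsum_mul_left]
  refine tsum_congr fun q => ?_
  simp only [Function.comp_apply, Equiv.prodComm_apply, Prod.swap_prod_mk, Int.divModEquiv_symm_apply]
  obtain ⟨c, hc⟩ := hab
  have heven : Even (a * q ^ 2 + b * q) := by
    obtain ⟨d, hd⟩ := Int.even_mul_succ_self q
    exact ⟨a * d + c * q, by
      have : b = a + (c + c) := by linarith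
      rw [this]; linear_combination (a : ℤ) * hd⟩
  obtain ⟨d, hd⟩ := heven
  have hd' : (a : ℂ) * q ^ 2 + b * q = d + d := by exact_mod_cast hd
  rw [← Complex.exp_add, Complex.exp_eq_exp_iff_exists_int]
  refine ⟨d + q * r, ?_⟩
  subst ht
  push_cast
  field_simp
  linear_combination (a * I) * hd'

open Complex Filter Topology in
/-- The quadratic Gauss sum `∑ exp(πi (r² + b r) / a)` for `b ≡ a (mod 2)`. -/
theorem gauss_sum_quadratic {a : ℕ} [NeZero a] {b : ℤ} (hab : Even (b - a)) :
    ∑ r : Fin a, cexp (Real.pi * I * ((r : ℕ) ^ 2 + b * (r : ℕ)) / a) =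
      (Real.sqrt a : ℝ) * cexp (Real.pi * I * (1 - (b : ℂ) ^ 2 / a) / 4) := by
  have ha0 : 0 < (a : ℝ) := by exact_mod_cast Nat.pos_of_ne_zero (NeZero.ne a)
  have ha : (a : ℂ) ≠ 0 := by exact_mod_cast NeZero.ne a
  set e : Fin a → ℂ := fun r => cexp (Real.pi * I * ((r : ℕ) ^ 2 + b * (r : ℕ)) / a) with he
  set ph : ℂ := cexp (-Real.pi * I * (b : ℂ) ^ 2 / (4 * a)) with hph
  let Θ : ℂ → ℝ → ℂ := fun W c => ∑' k : ℤ, cexp (-Real.pi * W * k ^ 2 - 2 * Real.pi * I * c * k)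
  let z : ℝ → ℂ := fun x => 1 / (1 / (x : ℂ) + I * a)
  have key : ∀ x : ℝ, 0 < x →
      ∑ r : Fin a, e r * ((1 - I / (a * x)) ^ (1 / 2 : ℂ) * Θ (x - I / a) ((r : ℕ) / a : ℝ)) =
        1 / (z x) ^ (1 / 2 : ℂ) * ph * Θ x (-b / (2 * a) : ℝ) := by
    intro x hx
    have hx0 : (x : ℂ) ≠ 0 := by exact_mod_cast hx.ne'
    have hden : 1 + I * a * x ≠ 0 := fun h => by
      have := congrArg Complex.re h
      simp at this
    have hden' : (1 / (x : ℂ) + I * a) ≠ 0 := fun h => hden (by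
      field_simp at h; linear_combination h)
    have hzre : 0 < (z x).re := by
      have : 0 < (1 / (x : ℂ) + I * a).re := by
        rw [← Complex.ofReal_one, ← Complex.ofReal_div]
        simpa using hx
      simp only [z, one_div, Complex.inv_re] at this ⊢
      exact div_pos this (Complex.normSq_pos.mpr (by simpa using hden'))
    have h1 := tsum_gaussian_residue_classes hab (t := z x + I / a) (z := z x) (by ring) hzre
    rw [Complex.tsum_exp_neg_quadratic hzre] at h1
    have hWre : (0 : ℝ) < ((x : ℂ) - I / a).re := by
      rw [← Complex.ofReal_natCast, Complex.sub_re, Complex.div_ofReal_re]; simpa using hx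
    have hW0 : ((x : ℂ) - I / a) ≠ 0 := fun h => by simp [h] at hWre
    have hT : (a : ℂ) ^ 2 * (z x + I / a) = 1 / (x - I / a) := by
      have hz : z x = x / (1 + I * a * x) := by
        simp only [z]
        rw [div_add' _ _ _ hx0, one_div_div]
      have hz' : z x + I / a = I / (a * (1 + I * a * x)) := by
        rw [hz, div_add_div _ _ hden ha, mul_comm (1 + I * a * x) (a : ℂ)]
        congr 1
        linear_combination a * x * I_mul_I
      rw [hz', eq_div_iff hW0, mul_div_assoc', div_mul_eq_mul_div, div_eq_one_iff_eq
        (mul_ne_zero ha hden)]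
      field_simp
      linear_combination -I_mul_I
    have h2 : ∀ r : Fin a,
        ∑' q : ℤ, cexp (-Real.pi * (a ^ 2 * (z x + I / a)) * (q + ((r : ℕ) / a : ℝ)) ^ 2) =
          (x : ℂ) ^ (1 / 2 : ℂ) *
            ((1 - I / (a * x)) ^ (1 / 2 : ℂ) * Θ (x - I / a) ((r : ℕ) / a : ℝ)) := by
      intro r
      have h3 := tsum_shifted_gaussian hWre ((r : ℕ) / a : ℝ)
      rw [hT]
      simp only [mul_one_div]
      rw [h3, ← mul_assoc]
      congr 1
      have hfac : (x : ℂ) - I / a = x * (1 - I / (a * x)) := by field_simp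
      have hne : (1 - I / (a * x)) ≠ 0 := fun h => hW0 (by rw [hfac, h, mul_zero])
      rw [hfac, Complex.cpow_def_of_ne_zero (mul_ne_zero hx0 hne), Complex.log_ofReal_mul hx hne,
        Complex.cpow_def_of_ne_zero hx0, Complex.cpow_def_of_ne_zero hne, ← Complex.exp_add,
        Complex.ofReal_log hx.le, add_mul]
    have h4 : ∑' n : ℤ, cexp (-Real.pi / z x * (n + I * (I * b / (2 * a))) ^ 2) =
        ph * ((x : ℂ) ^ (1 / 2 : ℂ) * Θ x (-b / (2 * a) : ℝ)) := by
      have h3 := tsum_shifted_gaussian (W := x) (by simpa using hx) (-b / (2 * a) : ℝ)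
      rw [← h3, ← tsum_mul_left]
      refine tsum_congr fun k => ?_
      obtain ⟨c, hc⟩ := hab
      have heven : Even (a * k ^ 2 - b * k) := by
        obtain ⟨d, hd⟩ := Int.even_mul_succ_self k
        exact ⟨a * d - c * k - a * k, by
          have : b = a + (c + c) := by linarith
          rw [this]; linear_combination (a : ℤ) * hd⟩
      obtain ⟨d, hd⟩ := heven
      have hd' : (a : ℂ) * k ^ 2 - b * k = d + d := by exact_mod_cast hd
      rw [hph, ← Complex.exp_add, Complex.exp_eq_exp_iff_exists_int]
      refine ⟨-d, ?_⟩
      simp only [z]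
      push_cast
      have hd2 : (d : ℂ) = (a * k ^ 2 - b * k) / 2 := by rw [hd']; ring
      rw [hd2, show I * (I * b / (2 * a)) = -(b : ℂ) / (2 * a) by
        rw [mul_div_assoc', ← mul_assoc, I_mul_I]; ring]
      field_simp
      ring
    rw [h4] at h1
    simp_rw [h2] at h1
    have hxc : (x : ℂ) ^ (1 / 2 : ℂ) ≠ 0 := by simp [Complex.cpow_eq_zero_iff, hx0]
    apply mul_left_cancel₀ hxc
    rw [Finset.mul_sum]
    calc _ = ∑ r : Fin a, e r * ((x : ℂ) ^ (1 / 2 : ℂ) *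
            ((1 - I / (a * x)) ^ (1 / 2 : ℂ) * Θ (x - I / a) ((r : ℕ) / a : ℝ))) :=
          Finset.sum_congr rfl fun r _ => by ring
      _ = _ := h1.symm.trans (by ring)
  have hinv : Tendsto (fun x : ℝ => (1 / x : ℂ)) atTop (𝓝 0) := by
    have := (Complex.continuous_ofReal.tendsto 0).comp tendsto_inv_atTop_zero
    simpa [Function.comp_def] using this
  have hΘ1 : ∀ c : ℝ, Tendsto (fun x : ℝ => Θ (x - I / a) c) atTop (𝓝 1) := fun c =>
    tendsto_tsum_gaussian_character (W := fun x => x - I / a) (by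
      have : (fun x : ℝ => ((x : ℂ) - I / a).re) = id := by
        funext x
        rw [← Complex.ofReal_natCast, Complex.sub_re, Complex.div_ofReal_re]; simp
      rw [this]; exact tendsto_id) c
  have hΘ2 : ∀ c : ℝ, Tendsto (fun x : ℝ => Θ x c) atTop (𝓝 1) := fun c =>
    tendsto_tsum_gaussian_character (W := fun x => x) (by
      simp only [Complex.ofReal_re]; exact tendsto_id) c
  have hc1 : Tendsto (fun x : ℝ => (1 - I / (a * x)) ^ (1 / 2 : ℂ)) atTop (𝓝 1) := by
    have h : Tendsto (fun x : ℝ => 1 - I / a * (1 / x : ℂ)) atTop (𝓝 (1 - I / a * 0)) :=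
      tendsto_const_nhds.sub (hinv.const_mul _)
    rw [mul_zero, sub_zero] at h
    have h' := h.cpow (tendsto_const_nhds (x := (1 / 2 : ℂ))) Complex.one_mem_slitPlane
    rw [Complex.one_cpow] at h'
    refine h'.congr fun x => ?_
    congr 2
    rw [div_mul_div_comm, mul_one]
  have hIa : I * (a : ℂ) ≠ 0 := mul_ne_zero I_ne_zero ha
  have hslit : 1 / (I * a) ∈ slitPlane := by
    rw [Complex.mem_slitPlane_iff]; right
    simp [Complex.inv_im, NeZero.ne a]
  have hc2 : Tendsto (fun x : ℝ => (z x) ^ (1 / 2 : ℂ)) atTop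
      (𝓝 ((1 / (I * a)) ^ (1 / 2 : ℂ))) := by
    have h : Tendsto z atTop (𝓝 (1 / (0 + I * a))) :=
      tendsto_const_nhds.div (hinv.add tendsto_const_nhds) (by simpa using hIa)
    rw [zero_add] at h
    exact h.cpow tendsto_const_nhds hslit
  have hL : Tendsto (fun x : ℝ => ∑ r : Fin a,
      e r * ((1 - I / (a * x)) ^ (1 / 2 : ℂ) * Θ (x - I / a) ((r : ℕ) / a : ℝ))) atTop
      (𝓝 (∑ r : Fin a, e r * (1 * 1))) :=
    tendsto_finsetSum _ fun r _ => (hc1.mul (hΘ1 _)).const_mul _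
  have hne : (1 / (I * a)) ^ (1 / 2 : ℂ) ≠ 0 := by
    rw [Ne, Complex.cpow_eq_zero_iff]; simp [ha]
  have hR : Tendsto (fun x : ℝ => 1 / (z x) ^ (1 / 2 : ℂ) * ph * Θ x (-b / (2 * a) : ℝ)) atTop
      (𝓝 (1 / (1 / (I * a)) ^ (1 / 2 : ℂ) * ph * 1)) :=
    ((tendsto_const_nhds.div hc2 hne).mul_const _).mul (hΘ2 _)
  have hlim := tendsto_nhds_unique (hL.congr' ((eventually_gt_atTop 0).mono key)) hR
  simp only [mul_one] at hlim
  rw [hlim, Complex.cpow_def_of_ne_zero (one_div_ne_zero hIa), one_div, ← Complex.exp_neg]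
  have hlog : Complex.log (1 / (I * a)) = -(Real.log a : ℂ) - Real.pi / 2 * I := by
    rw [show (1 / (I * a) : ℂ) = ((a⁻¹ : ℝ) : ℂ) * (-I) by
      push_cast; rw [one_div, mul_inv, Complex.inv_I]; ring,
      Complex.log_ofReal_mul (inv_pos.mpr ha0) (neg_ne_zero.mpr I_ne_zero), Complex.log_neg_I,
      Real.log_inv]
    push_cast
    ring
  rw [hlog, hph, Real.sqrt_eq_rpow, Real.rpow_def_of_pos ha0]
  push_cast
  rw [← Complex.exp_add, ← Complex.exp_add]
  congr 1
  field_simp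
  ring

/-- A sum of a quadratic function over a finite abelian group, trivial on a subgroup `H` whose
orthogonal complement is `H ∪ (w + H)`. -/
theorem sum_quadratic_of_orthogonal_complement {K : Type*} [AddCommGroup K] [Fintype K]
    (g : K → ℂ) (β : K → AddChar K ℂ) (hg : ∀ x y, g (x + y) = g x * g y * β x y)
    (H : AddSubgroup K) (hH : ∀ h ∈ H, g h = 1) {w : K} (hw : w ∉ H)
    (hperp : ∀ x, (∀ h ∈ H, β x h = 1) ↔ x ∈ H ∨ x - w ∈ H) :
    ∑ x, g x = (Nat.card H : ℂ) * (1 + g w) := by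
  classical
  have hcard : (Nat.card H : ℂ) ≠ 0 := by
    exact_mod_cast (Nat.card_pos (α := H)).ne'
  apply mul_left_cancel₀ hcard
  have h1 : ∀ h : H, ∑ x, g x * β x h = ∑ x, g x := fun h => by
    rw [← Equiv.sum_comp (Equiv.addRight (h : K)) g]
    exact Finset.sum_congr rfl fun x _ => by
      rw [Equiv.coe_addRight, hg, hH _ h.2, mul_one]
  have h2 : ∀ x, ∑ h : H, β x h = if x ∈ H ∨ x - w ∈ H then (Nat.card H : ℂ) else 0 := by
    intro x
    have h := AddChar.sum_eq_ite ((β x).compAddMonoidHom H.subtype)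
    rw [Nat.card_eq_fintype_card]
    have hiff : x ∈ H ∨ x - w ∈ H ↔ (β x).compAddMonoidHom H.subtype = 0 := by
      rw [← hperp, DFunLike.ext_iff]
      simp
    exact h.trans (if_congr hiff.symm rfl rfl)
  have h3 : ∀ x, x - w ∈ H → g x = g w := fun x hx => by
    have h := hg w (x - w)
    rwa [add_sub_cancel, hH _ hx, (hperp w).mpr (Or.inr (by simp [H.zero_mem])) _ hx, mul_one,
      mul_one] at h
  calc (Nat.card H : ℂ) * ∑ x, g x = ∑ h : H, ∑ x, g x * β x h := by
        rw [Finset.sum_congr rfl fun h _ => h1 h]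
        simp
    _ = ∑ x, g x * ∑ h : H, β x h := by
        rw [Finset.sum_comm]; simp_rw [Finset.mul_sum]
    _ = ∑ x, ((if x ∈ H then (Nat.card H : ℂ) else 0) +
          (if x - w ∈ H then (Nat.card H : ℂ) * g w else 0)) := by
        refine Finset.sum_congr rfl fun x _ => ?_
        rw [h2]
        by_cases hx : x ∈ H
        · have hxw : x - w ∉ H := fun h => hw (by simpa using H.sub_mem hx h)
          simp [hx, hxw, hH]
        · by_cases hxw : x - w ∈ H
          · simp [hx, hxw, h3, mul_comm]
          · simp [hx, hxw]
    _ = _ := by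
        have h4 : ∀ c : ℂ, ∑ x, (if x ∈ H then c else 0) = Nat.card H * c := fun c => by
          rw [← Finset.sum_filter, Finset.sum_const, nsmul_eq_mul, Nat.card_eq_fintype_card,
            Fintype.card_subtype]
        have h5 : ∑ x, (if x - w ∈ H then (Nat.card H : ℂ) * g w else 0) =
            Nat.card H * (Nat.card H * g w) := by
          rw [← h4 (Nat.card H * g w)]
          exact Equiv.sum_comp (Equiv.subRight w)
            fun x => if x ∈ H then (Nat.card H : ℂ) * g w else 0
        rw [Finset.sum_add_distrib, h4, h5]
        ring

section Grid

variable {E ι : Type*} [NormedAddCommGroup E] [InnerProductSpace ℝ E]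

/-- The function `x ↦ exp(πi (x·x + ξ·x))`. -/
def quadChar (ξ x : E) : ℂ := Complex.exp (Real.pi * Complex.I * ((⟪x, x⟫ + ⟪ξ, x⟫ : ℝ) : ℂ))

theorem quadChar_add (ξ x y : E) :
    quadChar ξ (x + y) =
      quadChar ξ x * quadChar ξ y * Complex.exp (2 * Real.pi * Complex.I * (⟪x, y⟫ : ℝ)) := by
  rw [quadChar, quadChar, quadChar, ← Complex.exp_add, ← Complex.exp_add, inner_add_add_self,
    inner_add_right, real_inner_comm x y]
  congr 1
  push_cast
  ring

theorem exp_two_pi_mul_eq_one_iff (x : ℝ) :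
    Complex.exp (2 * Real.pi * Complex.I * (x : ℂ)) = 1 ↔ ∃ k : ℤ, x = k := by
  rw [Complex.exp_eq_one_iff]
  refine exists_congr fun k => ?_
  rw [mul_comm (k : ℂ), mul_right_inj' Complex.two_pi_I_ne_zero]
  norm_cast

theorem quadChar_eq_one_iff (ξ x : E) :
    quadChar ξ x = 1 ↔ ∃ k : ℤ, ⟪x, x⟫ + ⟪ξ, x⟫ = 2 * (k : ℝ) := by
  rw [quadChar, show (Real.pi * Complex.I * ((⟪x, x⟫ + ⟪ξ, x⟫ : ℝ) : ℂ)) =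
    2 * Real.pi * Complex.I * (((⟪x, x⟫ + ⟪ξ, x⟫) / 2 : ℝ) : ℂ) by push_cast; ring,
    exp_two_pi_mul_eq_one_iff]
  exact exists_congr fun k => by rw [div_eq_iff two_ne_zero, mul_comm]

variable {v : ι → E} {a : ι → ℕ}

theorem quadChar_add_of_mem_closure {L : AddSubgroup E} (hvL : ∀ i, v i ∈ L) {ξ : E}
    (hchar : ∀ u ∈ L, quadChar ξ u = 1) {x m : E}
    (hm : m ∈ AddSubgroup.closure (Set.range v)) (hx : ∃ k : ℤ, ⟪x, m⟫ = k) :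
    quadChar ξ (x + m) = quadChar ξ x := by
  have hmL : m ∈ L := (AddSubgroup.closure_le L).mpr (Set.range_subset_iff.mpr hvL) hm
  rw [quadChar_add, hchar m hmL, (exp_two_pi_mul_eq_one_iff _).mpr hx, mul_one, mul_one]

variable [Fintype ι]

/-- The representative `∑ (κ i / a i) v i` of a class modulo the span of the `v i`. -/
def gridPoint (v : ι → E) {a : ι → ℕ} (κ : ∀ i, Fin (a i)) : E :=
  ∑ i, (((κ i : ℕ) : ℝ) / a i) • v i

theorem gridPoint_add_sub_mem [∀ i, NeZero (a i)] (κ μ : ∀ i, Fin (a i)) :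
    gridPoint v (κ + μ) - (gridPoint v κ + gridPoint v μ) ∈ AddSubgroup.closure (Set.range v) := by
  rw [gridPoint, gridPoint, gridPoint, ← Finset.sum_add_distrib, ← Finset.sum_sub_distrib]
  refine AddSubgroup.sum_mem _ fun i _ => ?_
  have ha : (a i : ℝ) ≠ 0 := by exact_mod_cast NeZero.ne (a i)
  obtain ⟨q, h⟩ : ∃ q : ℕ, (((κ + μ) i : Fin (a i)) : ℕ) + a i * q = (κ i : ℕ) + (μ i : ℕ) :=
    ⟨((κ i : ℕ) + (μ i : ℕ)) / a i, by
      rw [Pi.add_apply, Fin.val_add]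
      exact Nat.mod_add_div _ _⟩
  have h' : ((((κ + μ) i : Fin (a i)) : ℕ) : ℝ) =
      (κ i : ℕ) + (μ i : ℕ) - a i * (q : ℝ) := by
    rw [eq_sub_iff_add_eq]; exact_mod_cast h
  have h2 : (((((κ + μ) i : Fin (a i)) : ℕ) : ℝ) / a i) • v i -
      ((((κ i : ℕ) : ℝ) / a i) • v i + (((μ i : ℕ) : ℝ) / a i) • v i) =
      (-(q : ℤ)) • v i := by
    rw [h', ← add_smul, ← sub_smul, ← Int.cast_smul_eq_zsmul ℝ]
    congr 1
    push_cast
    field_simp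
    ring
  rw [h2]
  exact AddSubgroup.zsmul_mem _ (AddSubgroup.subset_closure (Set.mem_range_self i)) _

theorem exists_gridPoint_sub_mem [∀ i, NeZero (a i)]
    (hexp : ∀ x : E, x = ∑ i, (⟪x, v i⟫ / a i) • v i) {x : E} (hx : ∀ i, ∃ k : ℤ, ⟪x, v i⟫ = k) :
    ∃ κ : ∀ i, Fin (a i), gridPoint v κ - x ∈ AddSubgroup.closure (Set.range v) := by
  choose k hk using hx
  have hpos : ∀ i, (0 : ℤ) < a i := fun i => by exact_mod_cast Nat.pos_of_ne_zero (NeZero.ne (a i))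
  have hlt : ∀ i, (k i % a i).toNat < a i := fun i => by
    have := Int.emod_lt_of_pos (k i) (hpos i)
    have := Int.emod_nonneg (k i) (hpos i).ne'
    omega
  refine ⟨fun i => ⟨(k i % a i).toNat, hlt i⟩, ?_⟩
  rw [gridPoint, hexp x, ← Finset.sum_sub_distrib]
  refine AddSubgroup.sum_mem _ fun i _ => ?_
  have ha : (a i : ℝ) ≠ 0 := by exact_mod_cast NeZero.ne (a i)
  have h1 : ((k i % a i).toNat : ℝ) = k i - a i * (k i / a i : ℤ) := by
    have h := Int.toNat_of_nonneg (Int.emod_nonneg (k i) (hpos i).ne')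
    have h' : ((k i % a i).toNat : ℤ) = k i - a i * (k i / a i) := by rw [h, Int.emod_def]
    exact_mod_cast h'
  have h2 : ((((k i % a i).toNat : ℕ) : ℝ) / a i) • v i - (⟪x, v i⟫ / a i) • v i =
      (-(k i / a i : ℤ)) • v i := by
    rw [h1, hk, ← sub_smul, ← Int.cast_smul_eq_zsmul ℝ]
    congr 1
    push_cast
    field_simp
    ring
  dsimp only
  rw [h2]
  exact AddSubgroup.zsmul_mem _ (AddSubgroup.subset_closure (Set.mem_range_self i)) _

variable [DecidableEq ι]

theorem inner_gridPoint (hv : ∀ i j, ⟪v i, v j⟫ = if i = j then (a i : ℝ) else 0)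
    [∀ i, NeZero (a i)] (κ : ∀ i, Fin (a i)) (i : ι) :
    ⟪gridPoint v κ, v i⟫ = (κ i : ℕ) := by
  simp [gridPoint, sum_inner, inner_smul_left, hv]

theorem sum_quadChar_gridPoint (hv : ∀ i j, ⟪v i, v j⟫ = if i = j then (a i : ℝ) else 0)
    [∀ i, NeZero (a i)] (hexp : ∀ x : E, x = ∑ i, (⟪x, v i⟫ / a i) • v i) {ξ : E} {b : ι → ℤ}
    (hξ : ∀ i, ⟪ξ, v i⟫ = b i) (hb : ∀ i, Even (b i - a i)) :
    ∑ κ : (∀ i, Fin (a i)), quadChar ξ (gridPoint v κ) = (∏ i, Real.sqrt (a i) : ℝ) *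
      Complex.exp (Real.pi * Complex.I * (((Fintype.card ι : ℝ) - ⟪ξ, ξ⟫ : ℝ) : ℂ) / 4) := by
  have ha : ∀ i, (a i : ℝ) ≠ 0 := fun i => by exact_mod_cast NeZero.ne (a i)
  have h1 : ∀ κ : (∀ i, Fin (a i)), quadChar ξ (gridPoint v κ) =
      ∏ i, Complex.exp (Real.pi * Complex.I * (((κ i : ℕ) : ℂ) ^ 2 + b i * (κ i : ℕ)) / a i) := by
    intro κ
    have hs : ⟪gridPoint v κ, gridPoint v κ⟫ = ∑ i, ((κ i : ℕ) : ℝ) ^ 2 / a i := by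
      conv_lhs => rw [gridPoint, inner_sum]
      refine Finset.sum_congr rfl fun i _ => ?_
      rw [inner_smul_right]
      erw [inner_gridPoint hv]
      ring
    have hl : ⟪ξ, gridPoint v κ⟫ = ∑ i, (b i : ℝ) * (κ i : ℕ) / a i := by
      rw [gridPoint, inner_sum]
      refine Finset.sum_congr rfl fun i _ => ?_
      rw [inner_smul_right, hξ]
      ring
    rw [quadChar, hs, hl, ← Complex.exp_sum, ← Finset.sum_add_distrib, Complex.ofReal_sum,
      Finset.mul_sum]
    congr 1
    refine Finset.sum_congr rfl fun i _ => ?_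
    push_cast
    ring
  have h2 : ⟪ξ, ξ⟫ = ∑ i, (b i : ℝ) ^ 2 / a i := by
    conv_lhs => rw [hexp ξ, sum_inner]
    refine Finset.sum_congr rfl fun i _ => ?_
    rw [inner_smul_left, ← hexp, hξ, real_inner_comm ξ (v i), hξ, conj_trivial]
    ring
  simp_rw [h1]
  rw [← Fintype.piFinset_univ, ← Finset.prod_univ_sum (fun _ => Finset.univ)
    (fun i (r : Fin (a i)) =>
      Complex.exp (Real.pi * Complex.I * (((r : ℕ) : ℂ) ^ 2 + b i * (r : ℕ)) / a i))]
  rw [Finset.prod_congr rfl fun i _ => gauss_sum_quadratic (hb i), Finset.prod_mul_distrib,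
    ← Complex.exp_sum, ← Finset.sum_div, ← Finset.mul_sum, Finset.sum_sub_distrib, h2]
  push_cast
  simp

theorem exists_inner_gridPoint_eq_intCast
    (hv : ∀ i j, ⟪v i, v j⟫ = if i = j then (a i : ℝ) else 0) [∀ i, NeZero (a i)]
    (κ : ∀ i, Fin (a i)) {m : E} (hm : m ∈ AddSubgroup.closure (Set.range v)) :
    ∃ k : ℤ, ⟪gridPoint v κ, m⟫ = k := by
  induction hm using AddSubgroup.closure_induction with
  | mem x hx =>
    obtain ⟨i, rfl⟩ := hx
    exact ⟨(κ i : ℕ), by rw [inner_gridPoint hv]; push_cast; rfl⟩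
  | zero => exact ⟨0, by simp⟩
  | add x y _ _ hx hy =>
    obtain ⟨k, hk⟩ := hx
    obtain ⟨l, hl⟩ := hy
    exact ⟨k + l, by rw [inner_add_right, hk, hl]; push_cast; rfl⟩
  | neg x _ hx =>
    obtain ⟨k, hk⟩ := hx
    exact ⟨-k, by rw [inner_neg_right, hk]; push_cast; rfl⟩

/-- Milgram's formula for a lattice of index two in its dual, twisted by a characteristic
covector. -/
theorem one_add_quadChar_eq (L : AddSubgroup E)
    (hv : ∀ i j, ⟪v i, v j⟫ = if i = j then (a i : ℝ) else 0) (ha : ∀ i, a i ≠ 0)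
    (hexp : ∀ x : E, x = ∑ i, (⟪x, v i⟫ / a i) • v i) (hvL : ∀ i, v i ∈ L)
    (hint : ∀ x ∈ L, ∀ y ∈ L, ∃ k : ℤ, ⟪x, y⟫ = k) {w : E}
    (hw : ∀ u ∈ L, ∃ k : ℤ, ⟪w, u⟫ = k) (hwL : w ∉ L)
    (hdual : ∀ x, (∀ u ∈ L, ∃ k : ℤ, ⟪x, u⟫ = k) → x ∈ L ∨ x - w ∈ L) {ξ : E}
    (hξ : ∀ u ∈ L, ∃ k : ℤ, ⟪ξ, u⟫ = k)
    (hchar : ∀ u ∈ L, ∃ k : ℤ, ⟪ξ, u⟫ - ⟪u, u⟫ = 2 * (k : ℝ)) :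
    ∃ r : ℝ, 0 < r ∧ 1 + quadChar ξ w =
      r * Complex.exp (Real.pi * Complex.I * (((Fintype.card ι : ℝ) - ⟪ξ, ξ⟫ : ℝ) : ℂ) / 4) := by
  have : ∀ i, NeZero (a i) := fun i => ⟨ha i⟩
  have hML : AddSubgroup.closure (Set.range v) ≤ L :=
    (AddSubgroup.closure_le L).mpr (Set.range_subset_iff.mpr hvL)
  have hchar1 : ∀ u ∈ L, quadChar ξ u = 1 := fun u hu => by
    obtain ⟨k, hk⟩ := hchar u hu
    obtain ⟨l, hl⟩ := hint u hu u hu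
    exact (quadChar_eq_one_iff ξ u).mpr ⟨k + l, by push_cast; linarith⟩
  set e : (∀ i, Fin (a i)) → E := gridPoint v with he
  have he0 : e 0 = 0 := by simp [he, gridPoint]
  have hadd : ∀ κ μ, ∃ m ∈ AddSubgroup.closure (Set.range v), e (κ + μ) = e κ + e μ + m :=
    fun κ μ => ⟨_, gridPoint_add_sub_mem κ μ, by simp [he]⟩
  have hpair : ∀ κ, ∀ m ∈ AddSubgroup.closure (Set.range v), ∃ k : ℤ, ⟪e κ, m⟫ = k :=
    fun κ m hm => exists_inner_gridPoint_eq_intCast hv κ hm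
  let β : (∀ i, Fin (a i)) → AddChar (∀ i, Fin (a i)) ℂ := fun κ =>
    { toFun := fun μ => Complex.exp (2 * Real.pi * Complex.I * (⟪e κ, e μ⟫ : ℝ))
      map_zero_eq_one' := by simp [he0]
      map_add_eq_mul' := fun μ ν => by
        obtain ⟨m, hm, h⟩ := hadd μ ν
        rw [h, inner_add_right, inner_add_right, Complex.ofReal_add, Complex.ofReal_add, mul_add,
          mul_add, Complex.exp_add, Complex.exp_add,
          (exp_two_pi_mul_eq_one_iff _).mpr (hpair κ m hm), mul_one] }
  have hβ : ∀ κ μ, β κ μ = Complex.exp (2 * Real.pi * Complex.I * (⟪e κ, e μ⟫ : ℝ)) :=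
    fun _ _ => rfl
  have hg : ∀ κ μ, quadChar ξ (e (κ + μ)) = quadChar ξ (e κ) * quadChar ξ (e μ) * β κ μ := by
    intro κ μ
    obtain ⟨m, hm, h⟩ := hadd κ μ
    have hκμ : ∃ k : ℤ, ⟪e κ + e μ, m⟫ = k := by
      obtain ⟨k, hk⟩ := hpair κ m hm
      obtain ⟨l, hl⟩ := hpair μ m hm
      exact ⟨k + l, by rw [inner_add_left, hk, hl]; push_cast; rfl⟩
    rw [h, quadChar_add_of_mem_closure hvL hchar1 hm hκμ, quadChar_add, hβ]
  have hmem_add : ∀ κ μ, e (κ + μ) ∈ L ↔ e κ + e μ ∈ L := fun κ μ => by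
    obtain ⟨m, hm, h⟩ := hadd κ μ
    rw [h, L.add_mem_cancel_right (hML hm)]
  let H : AddSubgroup (∀ i, Fin (a i)) :=
    { carrier := {κ | e κ ∈ L}
      zero_mem' := by simp [he0, L.zero_mem]
      add_mem' := fun {κ μ} hκ hμ => (hmem_add κ μ).mpr (L.add_mem hκ hμ)
      neg_mem' := fun {κ} hκ => by
        have h := (hmem_add κ (-κ)).mp (by rw [add_neg_cancel, he0]; exact L.zero_mem)
        exact (L.add_mem_cancel_left hκ).mp h }
  have hmemH : ∀ κ, κ ∈ H ↔ e κ ∈ L := fun _ => Iff.rfl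
  obtain ⟨ω, hω⟩ := exists_gridPoint_sub_mem hexp fun i => hw _ (hvL i)
  have hsub : ∀ κ, κ - ω ∈ H ↔ e κ - w ∈ L := fun κ => by
    obtain ⟨m, hm, h⟩ := hadd (κ - ω) ω
    rw [sub_add_cancel] at h
    have : e κ - w = e (κ - ω) + ((e ω - w) + m) := by rw [h]; abel
    rw [hmemH, this, L.add_mem_cancel_right (L.add_mem (hML hω) (hML hm))]
  have hωH : ω ∉ H := fun h => hwL (by
    have := L.sub_mem ((hmemH ω).mp h) (hML hω)
    rwa [he, sub_sub_cancel] at this)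
  have hgω : quadChar ξ (e ω) = quadChar ξ w := by
    have h := quadChar_add_of_mem_closure hvL hchar1 (x := w) hω (hw _ (hML hω))
    rwa [add_sub_cancel] at h
  have hperp : ∀ κ, (∀ h ∈ H, β κ h = 1) ↔ κ ∈ H ∨ κ - ω ∈ H := by
    intro κ
    rw [hsub, hmemH]
    constructor
    · intro h
      apply hdual
      intro u hu
      obtain ⟨μ, hμ⟩ := exists_gridPoint_sub_mem hexp fun i => hint u hu _ (hvL i)
      have hμL : e μ ∈ L := by simpa using L.add_mem (hML hμ) hu
      have h1 := h μ hμL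
      rw [hβ, exp_two_pi_mul_eq_one_iff] at h1
      obtain ⟨k, hk⟩ := h1
      obtain ⟨l, hl⟩ := hpair κ _ hμ
      refine ⟨k - l, ?_⟩
      rw [inner_sub_right] at hl
      push_cast
      linarith
    · intro h μ hμ
      rw [hβ, exp_two_pi_mul_eq_one_iff]
      rcases h with h | h
      · exact hint _ h _ hμ
      · obtain ⟨k, hk⟩ := hint _ h _ hμ
        obtain ⟨l, hl⟩ := hw _ hμ
        refine ⟨k + l, ?_⟩
        rw [inner_sub_left] at hk
        push_cast
        linarith
  have hsum := sum_quadratic_of_orthogonal_complement (fun κ => quadChar ξ (e κ)) β hg H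
    (fun h hh => hchar1 _ hh) hωH hperp
  choose b hb using fun i => hξ _ (hvL i)
  have heven : ∀ i, Even (b i - a i) := fun i => by
    obtain ⟨k, hk⟩ := hchar _ (hvL i)
    rw [hb, hv, if_pos rfl] at hk
    exact ⟨k, by rw [← two_mul]; exact_mod_cast hk⟩
  rw [sum_quadChar_gridPoint hv hexp hb heven] at hsum
  simp only [hgω] at hsum
  have hcard : (0 : ℝ) < Nat.card H := by exact_mod_cast Nat.card_pos
  have hcardc : (Nat.card H : ℂ) ≠ 0 := by exact_mod_cast hcard.ne'
  refine ⟨(∏ i, Real.sqrt (a i)) / Nat.card H, div_pos (Finset.prod_pos fun i _ =>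
    Real.sqrt_pos.mpr (by exact_mod_cast Nat.pos_of_ne_zero (ha i))) hcard, ?_⟩
  apply mul_left_cancel₀ hcardc
  rw [← hsum]
  push_cast
  field_simp

end Grid

section OrthogonalSublattice

variable {E : Type*} [NormedAddCommGroup E] [InnerProductSpace ℝ E]

/-- The vectors with a nonzero integer multiple in `L`. -/
def isolator (L : AddSubgroup E) : AddSubgroup E where
  carrier := {x | ∃ N : ℤ, N ≠ 0 ∧ N • x ∈ L}
  zero_mem' := ⟨1, one_ne_zero, by simp [L.zero_mem]⟩
  add_mem' := by
    rintro x y ⟨N, hN, hx⟩ ⟨K, hK, hy⟩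
    refine ⟨N * K, mul_ne_zero hN hK, ?_⟩
    rw [smul_add, mul_comm, mul_smul, mul_comm, mul_smul]
    exact L.add_mem (L.zsmul_mem hx K) (L.zsmul_mem hy N)
  neg_mem' := by
    rintro x ⟨N, hN, hx⟩
    exact ⟨N, hN, by rw [smul_neg]; exact L.neg_mem hx⟩

theorem projection_mem_isolator {L : AddSubgroup E}
    (hint : ∀ x ∈ L, ∀ y ∈ L, ∃ k : ℤ, ⟪x, y⟫ = k) {x y : E} (hx : x ∈ isolator L) (hy : y ∈ L) :
    (⟪x, y⟫ / ‖x‖ ^ 2) • x ∈ isolator L := by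
  obtain ⟨N, hN, hNx⟩ := hx
  by_cases hx0 : x = 0
  · simp [hx0, (isolator L).zero_mem]
  obtain ⟨k, hk⟩ := hint _ hNx _ hNx
  obtain ⟨l, hl⟩ := hint _ hNx _ hy
  have hN' : (N : ℝ) ≠ 0 := by exact_mod_cast hN
  have hx0' : ‖x‖ ≠ 0 := norm_ne_zero_iff.mpr hx0
  simp only [← Int.cast_smul_eq_zsmul ℝ, inner_smul_left, inner_smul_right,
    real_inner_self_eq_norm_sq, conj_trivial] at hk hl
  refine ⟨k, fun h => ?_, ?_⟩
  · rw [h] at hk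
    have : (N : ℝ) * (N * ‖x‖ ^ 2) ≠ 0 := by positivity
    exact this (by simpa using hk)
  · have : k • (⟪x, y⟫ / ‖x‖ ^ 2) • x = l • N • x := by
      simp only [← Int.cast_smul_eq_zsmul ℝ, smul_smul]
      congr 1
      rw [← hk, ← hl]
      field_simp
    rw [this]
    exact L.zsmul_mem hNx l

/-- An integral lattice contains an orthogonal basis of the ambient space. -/
theorem exists_orthogonal_basis_mem [FiniteDimensional ℝ E] (L : AddSubgroup E)
    (hint : ∀ x ∈ L, ∀ y ∈ L, ∃ k : ℤ, ⟪x, y⟫ = k) {n : ℕ} {b : Fin n → E} (hbL : ∀ i, b i ∈ L)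
    (hb : LinearIndependent ℝ b) (hn : Module.finrank ℝ E = n) :
    ∃ (v : Fin n → E) (a : Fin n → ℕ), (∀ i, v i ∈ L) ∧ (∀ i, a i ≠ 0) ∧
      (∀ i j, ⟪v i, v j⟫ = if i = j then (a i : ℝ) else 0) ∧
      ∀ x : E, x = ∑ i, (⟪x, v i⟫ / a i) • v i := by
  have hgs : ∀ i, InnerProductSpace.gramSchmidt ℝ b i ∈ isolator L := by
    intro i
    induction i using WellFoundedLT.induction with
    | ind i ih =>
      rw [eq_sub_of_add_eq (InnerProductSpace.gramSchmidt_def'' ℝ b i).symm]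
      refine (isolator L).sub_mem ⟨1, one_ne_zero, by simpa using hbL i⟩ ?_
      exact (isolator L).sum_mem fun j hj =>
        projection_mem_isolator hint (ih j (Finset.mem_Iio.mp hj)) (hbL i)
  choose N hN hNL using hgs
  let v : Fin n → E := fun i => N i • InnerProductSpace.gramSchmidt ℝ b i
  have hv0 : ∀ i, v i ≠ 0 := fun i => by
      simp only [v, ← Int.cast_smul_eq_zsmul ℝ]
      exact smul_ne_zero (by exact_mod_cast hN i) (InnerProductSpace.gramSchmidt_ne_zero i hb)
  have horth : ∀ i j, i ≠ j → ⟪v i, v j⟫ = 0 := fun i j hij => by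
    simp only [v, ← Int.cast_smul_eq_zsmul ℝ, inner_smul_left, inner_smul_right,
      InnerProductSpace.gramSchmidt_orthogonal ℝ b hij, mul_zero]
  have hself : ∀ i, ∃ k : ℕ, k ≠ 0 ∧ ⟪v i, v i⟫ = (k : ℝ) := fun i => by
    obtain ⟨k, hk⟩ := hint _ (hNL i) _ (hNL i)
    have hpos : 0 < ⟪v i, v i⟫ := real_inner_self_pos.mpr (hv0 i)
    have hkpos : 0 < k := by
      rw [show ⟪v i, v i⟫ = (k : ℝ) from hk] at hpos
      exact_mod_cast hpos
    lift k to ℕ using hkpos.le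
    exact ⟨k, by omega, by simpa using hk⟩
  choose a ha hav using hself
  refine ⟨v, a, hNL, ha, fun i j => ?_, fun x => ?_⟩
  · split_ifs with h
    · rw [← h, hav]
    · exact horth i j h
  · have hspan : Submodule.span ℝ (Set.range v) = ⊤ :=
      (linearIndependent_of_ne_zero_of_inner_eq_zero hv0
        fun i j h => horth i j h).span_eq_top_of_card_eq_finrank' (by simp [hn])
    rw [← sub_eq_zero, ← inner_self_eq_zero (𝕜 := ℝ)]
    set y := x - ∑ i, (⟪x, v i⟫ / a i) • v i with hy
    have hyv : ∀ j, ⟪v j, y⟫ = 0 := fun j => by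
      have haj : (a j : ℝ) ≠ 0 := by exact_mod_cast ha j
      rw [hy, inner_sub_right, inner_sum, Finset.sum_eq_single j]
      · rw [inner_smul_right, hav, div_mul_cancel₀ _ haj, real_inner_comm, sub_self]
      · intro i _ hij
        rw [inner_smul_right, horth j i hij.symm, mul_zero]
      · simp
    have hall : ∀ z ∈ Submodule.span ℝ (Set.range v), ⟪z, y⟫ = 0 := fun z hz => by
      induction hz using Submodule.span_induction with
      | mem z hz => obtain ⟨j, rfl⟩ := hz; exact hyv j
      | zero => simp
      | add z t _ _ hz ht => rw [inner_add_left, hz, ht, add_zero]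
      | smul c z _ hz => rw [inner_smul_left, hz, mul_zero]
    exact hall y (hspan ▸ Submodule.mem_top)

end OrthogonalSublattice

section Bidual

variable {E : Type*} [NormedAddCommGroup E] [InnerProductSpace ℝ E]

/-- A lattice with a basis is its own bidual. -/
theorem mem_of_inner_dual_intCast [FiniteDimensional ℝ E] {ι : Type*} [Fintype ι]
    (L : AddSubgroup E) (b : Module.Basis ι ℝ E) (hbL : ∀ i, b i ∈ L) {w : E}
    (hbspan : ∀ x ∈ L, x ∈ Submodule.span ℤ (Set.range b))
    (hw : ∀ x, (∀ u ∈ L, ∃ k : ℤ, ⟪x, u⟫ = k) → ∃ k : ℤ, ⟪w, x⟫ = k) : w ∈ L := by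
  have hnd : LinearMap.BilinForm.Nondegenerate (innerₗ E : LinearMap.BilinForm ℝ E) :=
    ⟨fun x hx => by simpa using hx x, fun x hx => by simpa using hx x⟩
  have hsymm : LinearMap.BilinForm.IsSymm (innerₗ E : LinearMap.BilinForm ℝ E) :=
    ⟨fun x y => by simp [real_inner_comm]⟩
  have h := LinearMap.BilinForm.dualSubmodule_dualSubmodule_of_basis (R := ℤ)
    (innerₗ E : LinearMap.BilinForm ℝ E) hnd hsymm b
  have hle : Submodule.span ℤ (Set.range b) ≤ AddSubgroup.toIntSubmodule L :=
    Submodule.span_le.mpr (Set.range_subset_iff.mpr hbL)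
  apply hle
  rw [← h, LinearMap.BilinForm.mem_dualSubmodule]
  intro x hx
  rw [LinearMap.BilinForm.mem_dualSubmodule] at hx
  obtain ⟨k, hk⟩ := hw x fun u hu => by
    obtain ⟨k, hk⟩ := Submodule.mem_one.mp (hx u (hbspan u hu))
    exact ⟨k, by simpa using hk.symm⟩
  exact Submodule.mem_one.mpr ⟨k, by simpa using hk.symm⟩

end Bidual

/-- The underlying subgroup of a lattice. -/
def IsLattice.toAddSubgroup {n : ℕ} {Λ : Set (EuclideanSpace ℝ (Fin n))} (h : IsLattice Λ) :
    AddSubgroup (EuclideanSpace ℝ (Fin n)) where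
  carrier := Λ
  zero_mem' := h.1.1
  add_mem' := fun {x y} hx hy => h.1.2.1 x hx y hy
  neg_mem' := fun {x} hx => h.1.2.2 x hx

theorem IsLattice.exists_basis {n : ℕ} {Λ : Set (EuclideanSpace ℝ (Fin n))} (h : IsLattice Λ) :
    ∃ b : Module.Basis (Fin n) ℝ (EuclideanSpace ℝ (Fin n)), (∀ i, b i ∈ Λ) ∧
      ∀ x ∈ Λ, x ∈ Submodule.span ℤ (Set.range b) := by
  obtain ⟨-, ⟨b, hbL, -, hb⟩, hspan, -⟩ := h
  have htop : ⊤ ≤ Submodule.span ℝ (Set.range b) := by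
    rw [← hspan, Submodule.span_le]
    intro x hx
    obtain ⟨c, rfl⟩ := hb x hx
    exact Submodule.sum_mem _ fun i _ =>
      Submodule.smul_mem _ _ (Submodule.subset_span (Set.mem_range_self i))
  have hli : LinearIndependent ℝ b :=
    linearIndependent_of_top_le_span_of_card_eq_finrank htop (by simp)
  refine ⟨Module.Basis.mk hli htop, fun i => by simpa using hbL i, fun x hx => ?_⟩
  obtain ⟨c, rfl⟩ := hb x hx
  refine Submodule.sum_mem _ fun i _ => ?_
  rw [Int.cast_smul_eq_zsmul]
  exact Submodule.smul_mem _ _ (Submodule.subset_span ⟨i, by simp⟩)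

/-- If `exp(πi x/4)` has the same argument as `1 + exp(πi σ/2)` for `σ = ±1`, then
`x ≡ σ (mod 8)`. -/
theorem exists_eq_add_eight_mul_of_one_add_exp {x r : ℝ} {σ : ℤ} (hσ : σ = 1 ∨ σ = -1)
    (hr : 0 < r) (h : 1 + Complex.exp (Real.pi * Complex.I * ((σ / 2 : ℝ) : ℂ)) =
      r * Complex.exp (Real.pi * Complex.I * (x : ℂ) / 4)) :
    ∃ k : ℤ, x = σ + 8 * (k : ℝ) := by
  have hsqrt : 1 + Complex.exp (Real.pi * Complex.I * ((σ / 2 : ℝ) : ℂ)) =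
      (2 * Real.cos (Real.pi / 4) : ℝ) * Complex.exp (Real.pi * Complex.I * (σ : ℂ) / 4) := by
    have hcos : Real.cos (Real.pi / 4) = Real.cos (Real.pi * σ / 4) := by
      rcases hσ with rfl | rfl
      · simp
      · rw [← Real.cos_neg]; push_cast; ring_nf
    rw [hcos, Complex.ofReal_mul, Complex.ofReal_cos, Complex.cos]
    push_cast
    rw [mul_div_cancel₀ _ (two_ne_zero' ℂ), add_mul, ← Complex.exp_add, ← Complex.exp_add, add_comm]
    congr 1
    · congr 1; ring
    · rw [← Complex.exp_zero]; congr 1; ring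
  have hcospos : 0 < 2 * Real.cos (Real.pi / 4) := by
    rw [Real.cos_pi_div_four]; positivity
  rw [hsqrt] at h
  have hexp : ∀ y : ℝ, ‖Complex.exp (Real.pi * Complex.I * (y : ℂ) / 4)‖ = 1 := fun y => by
    rw [show (Real.pi * Complex.I * (y : ℂ) / 4) = ((Real.pi * y / 4 : ℝ) : ℂ) * Complex.I by
      push_cast; ring, Complex.norm_exp_ofReal_mul_I]
  have hnorm := congrArg norm h
  rw [norm_mul, norm_mul, hexp, ← Complex.ofReal_intCast, hexp, Complex.norm_real,
    Complex.norm_real, Real.norm_of_nonneg hr.le, Real.norm_of_nonneg hcospos.le, mul_one,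
    mul_one] at hnorm
  rw [hnorm] at h
  have h' := mul_left_cancel₀ (by exact_mod_cast hr.ne') h
  rw [eq_comm, Complex.exp_eq_exp_iff_exists_int] at h'
  obtain ⟨k, hk⟩ := h'
  refine ⟨k, ?_⟩
  have hpi : (Real.pi * Complex.I : ℂ) ≠ 0 :=
    mul_ne_zero (by exact_mod_cast Real.pi_ne_zero) Complex.I_ne_zero
  have : (x : ℂ) = σ + 8 * k := by
    apply mul_left_cancel₀ hpi
    linear_combination 4 * hk
  exact_mod_cast this

/-- For a characteristic covector `ξ` of a bimodular lattice, the residue of `ξ·ξ` modulo `8` is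
determined by the residue of `w·w + ξ·w` modulo `2`, for any `w` in the nontrivial class of the
discriminant group. -/
theorem IsBimodular.exists_charSign {n : ℕ} {L : Set (EuclideanSpace ℝ (Fin n))}
    (hL : IsBimodular L) {w : EuclideanSpace ℝ (Fin n)} (hw : w ∈ dualSet L \ L)
    {ξ : EuclideanSpace ℝ (Fin n)} (hξ : ξ ∈ CharSet L) :
    ∃ ε : ℤ, (ε = 1 ∨ ε = -1) ∧ ξ ∈ CharSign L ε ∧
      ∃ k : ℤ, ⟪w, w⟫ + ⟪ξ, w⟫ = -(ε : ℝ) / 2 + 2 * (k : ℝ) := by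
  obtain ⟨hlat, w₀, -, hw₀⟩ := hL
  obtain ⟨hwd, hwL⟩ := hw
  have hξ' := hξ
  obtain ⟨hξd, hchar⟩ := hξ
  set Λ := hlat.toAddSubgroup with hΛ
  have hdual : ∀ x, (∀ u ∈ Λ, ∃ k : ℤ, ⟪x, u⟫ = (k : ℝ)) → x ∈ Λ ∨ x - w ∈ Λ := fun x hx => by
    have h1 : w - w₀ ∈ Λ := (hw₀ w hwd).resolve_left hwL
    refine (hw₀ x hx).imp id fun h2 => ?_
    simpa using Λ.sub_mem h2 h1
  have hint := hlat.2.2.2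
  obtain ⟨b, hbL, hbspan⟩ := hlat.exists_basis
  have hww : ¬ ∃ k : ℤ, ⟪w, w⟫ = (k : ℝ) := by
    rintro ⟨k, hk⟩
    refine hwL (mem_of_inner_dual_intCast Λ b hbL hbspan fun x hx => ?_)
    rcases hdual x hx with h | h
    · exact hwd x h
    · obtain ⟨l, hl⟩ := hwd _ h
      rw [inner_sub_right] at hl
      exact ⟨l + k, by push_cast; linarith⟩
  have h2w : w + w ∈ Λ := by
    rcases hdual (w + w) fun u hu => by
      obtain ⟨k, hk⟩ := hwd u hu
      exact ⟨k + k, by rw [inner_add_left, hk]; push_cast; rfl⟩ with h | h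
    · exact h
    · rw [add_sub_cancel_right] at h
      exact absurd h hwL
  obtain ⟨p, hp⟩ := hwd _ h2w
  obtain ⟨j, hj⟩ := hchar _ h2w
  simp only [inner_add_right, inner_add_left] at hp hj
  have hpodd : p % 2 = 1 := by
    by_contra h
    refine hww ⟨p / 2, ?_⟩
    have h2 : p = 2 * (p / 2) := by omega
    have h3 : (p : ℝ) = 2 * ((p / 2 : ℤ) : ℝ) := by exact_mod_cast h2
    linarith
  obtain ⟨σ, c, hσ, hσc⟩ : ∃ σ c : ℤ, (σ = 1 ∨ σ = -1) ∧ 3 * p + 2 * j = σ + 4 * c := by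
    rcases (by omega : (3 * p + 2 * j) % 4 = 1 ∨ (3 * p + 2 * j) % 4 = 3) with h | h
    · exact ⟨1, (3 * p + 2 * j) / 4, Or.inl rfl, by omega⟩
    · exact ⟨-1, (3 * p + 2 * j) / 4 + 1, Or.inr rfl, by omega⟩
  have hσc' : 3 * (p : ℝ) + 2 * j = σ + 4 * c := by exact_mod_cast hσc
  have hq : ⟪w, w⟫ + ⟪ξ, w⟫ = (σ : ℝ) / 2 + 2 * (c : ℝ) := by linarith
  obtain ⟨v, a, hvL, ha, hv, hexp⟩ :=
    exists_orthogonal_basis_mem Λ hint hbL b.linearIndependent (by simp)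
  obtain ⟨r, hr, h⟩ := one_add_quadChar_eq Λ hv ha hexp hvL hint hwd hwL hdual hξd hchar
  have hqc : quadChar ξ w = Complex.exp (Real.pi * Complex.I * ((σ / 2 : ℝ) : ℂ)) := by
    rw [quadChar, hq, Complex.exp_eq_exp_iff_exists_int]
    exact ⟨c, by push_cast; ring⟩
  rw [hqc] at h
  obtain ⟨k, hk⟩ := exists_eq_add_eight_mul_of_one_add_exp hσ hr h
  rw [Fintype.card_fin] at hk
  refine ⟨-σ, by omega, ⟨hξ', -k, ?_⟩, c, ?_⟩
  · push_cast; linarith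
  · rw [hq]; push_cast; ring

theorem CharSign.eq_of_mem {n : ℕ} {L : Set (EuclideanSpace ℝ (Fin n))} {ε δ : ℤ}
    {ξ : EuclideanSpace ℝ (Fin n)} (hε : ε = 1 ∨ ε = -1) (hδ : δ = 1 ∨ δ = -1)
    (h : ξ ∈ CharSign L ε) (h' : ξ ∈ CharSign L δ) : ε = δ := by
  obtain ⟨-, k, hk⟩ := h
  obtain ⟨-, l, hl⟩ := h'
  have : (ε : ℝ) + 8 * k = δ + 8 * l := by linarith
  have : ε + 8 * k = δ + 8 * l := by exact_mod_cast this
  omega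

theorem inner_pairE {n m : ℕ} (ξ : EuclideanSpace ℝ (Fin (n + m))) (x : EuclideanSpace ℝ (Fin n))
    (y : EuclideanSpace ℝ (Fin m)) :
    ⟪ξ, pairE x y⟫ = ⟪restFst ξ, x⟫ + ⟪restSnd ξ, y⟫ := by
  simp [PiLp.inner_apply, pairE, restFst, restSnd, Fin.sum_univ_add]

theorem restFst_pairE {n m : ℕ} (x : EuclideanSpace ℝ (Fin n)) (y : EuclideanSpace ℝ (Fin m)) :
    restFst (pairE x y) = x := by
  ext; simp [restFst, pairE]

theorem restSnd_pairE {n m : ℕ} (x : EuclideanSpace ℝ (Fin n)) (y : EuclideanSpace ℝ (Fin m)) :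
    restSnd (pairE x y) = y := by
  ext; simp [restSnd, pairE]

theorem inner_pairE_self {n m : ℕ} (x : EuclideanSpace ℝ (Fin n))
    (y : EuclideanSpace ℝ (Fin m)) : ⟪pairE x y, pairE x y⟫ = ⟪x, x⟫ + ⟪y, y⟫ := by
  rw [inner_pairE, restFst_pairE, restSnd_pairE]

/-- an element `ξ` of the dual of the unimodular overlattice `U_A` is characteristic
iff there is a sign `ε = ±1` such that its `ℝ^n`-component lies in `Char_ε(L)` and its
`ℝ^m`-component lies in `Char_{−ε}(A)`. -/
theorem stmt4 {n m : ℕ} (L : Set (EuclideanSpace ℝ (Fin n)))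
    (A : Set (EuclideanSpace ℝ (Fin m))) (hL : IsBimodular L) (hA : IsBimodular A)
    (ξ : EuclideanSpace ℝ (Fin (n + m))) (hξ : ξ ∈ dualSet (overLattice L A)) :
    ξ ∈ CharSet (overLattice L A) ↔
      ∃ ε : ℤ, (ε = 1 ∨ ε = -1) ∧ restFst ξ ∈ CharSign L ε ∧ restSnd ξ ∈ CharSign A (-ε) := by
  constructor
  · rintro ⟨-, hchar⟩
    have hL0 : (0 : EuclideanSpace ℝ (Fin n)) ∈ L := hL.1.1.1
    have hA0 : (0 : EuclideanSpace ℝ (Fin m)) ∈ A := hA.1.1.1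
    have hfst : restFst ξ ∈ CharSet L := by
      refine ⟨fun x hx => ?_, fun x hx => ?_⟩
      · simpa [inner_pairE] using hξ (pairE x 0) (Or.inl ⟨x, hx, 0, hA0, rfl⟩)
      · obtain ⟨k, hk⟩ := hchar (pairE x 0) (Or.inl ⟨x, hx, 0, hA0, rfl⟩)
        rw [inner_pairE, inner_pairE_self] at hk
        exact ⟨k, by simpa only [inner_zero_right, add_zero, zero_add] using hk⟩
    have hsnd : restSnd ξ ∈ CharSet A := by
      refine ⟨fun y hy => ?_, fun y hy => ?_⟩
      · simpa [inner_pairE] using hξ (pairE 0 y) (Or.inl ⟨0, hL0, y, hy, rfl⟩)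
      · obtain ⟨k, hk⟩ := hchar (pairE 0 y) (Or.inl ⟨0, hL0, y, hy, rfl⟩)
        rw [inner_pairE, inner_pairE_self] at hk
        exact ⟨k, by simpa only [inner_zero_right, add_zero, zero_add] using hk⟩
    obtain ⟨x, hx, -⟩ := hL.2
    obtain ⟨y, hy, -⟩ := hA.2
    obtain ⟨ε, hε, hεL, k, hk⟩ := hL.exists_charSign hx hfst
    obtain ⟨δ, hδ, hδA, l, hl⟩ := hA.exists_charSign hy hsnd
    obtain ⟨p, hp⟩ := hξ _ (Or.inr ⟨x, hx, y, hy, rfl⟩)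
    obtain ⟨j, hj⟩ := hchar _ (Or.inr ⟨x, hx, y, hy, rfl⟩)
    rw [inner_pairE_self, hp] at hj
    rw [inner_pairE] at hp
    have hsum : (ε : ℝ) + δ = 4 * (k + l - p + j) := by linarith
    have hsum' : ε + δ = 4 * (k + l - p + j) := by exact_mod_cast hsum
    have hδε : δ = -ε := by omega
    exact ⟨ε, hε, hεL, hδε ▸ hδA⟩
  · rintro ⟨ε, hε, hfst, hsnd⟩
    refine ⟨hξ, ?_⟩
    rintro z (⟨x, hx, y, hy, rfl⟩ | ⟨x, hx, y, hy, rfl⟩)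
    · obtain ⟨k, hk⟩ := hfst.1.2 x hx
      obtain ⟨l, hl⟩ := hsnd.1.2 y hy
      exact ⟨k + l, by rw [inner_pairE, inner_pairE_self]; push_cast; linarith⟩
    · obtain ⟨δ, hδ, hδL, k, hk⟩ := hL.exists_charSign hx hfst.1
      obtain ⟨η, hη, hηA, l, hl⟩ := hA.exists_charSign hy hsnd.1
      obtain rfl := CharSign.eq_of_mem hε hδ hfst hδL
      obtain rfl := CharSign.eq_of_mem (by omega) hη hsnd hηA
      obtain ⟨p, hp⟩ := hξ _ (Or.inr ⟨x, hx, y, hy, rfl⟩)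
      refine ⟨p - k - l, ?_⟩
      rw [inner_pairE_self, hp]
      rw [inner_pairE] at hp
      push_cast at hl ⊢
      linarith
end
end
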